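/- arXiv:1608.03118 — 13 statements merged into one kernel-verified Lean document; each statement's English description precedes it below -/
import Mathlib

section
/- Let G = (V,E) be a finite simple graph with arboricity at most c (its edge set can be partitioned into at most c forests), let M* denote the size of a maximum matching of G, and let μ be an integer with μ > 2c. Then the number h_μ of vertices of G whose degree exceeds μ satisfies h_μ ≤ (2μ/(μ − 2c + 1))·M*. -/
open SimpleGraph

variable {V : Type*}

/-- `G` has arboricity at most `c`: its edge set can be partitioned into
at most `c` forests (equivalently, covered by `c` acyclic subgraphs). -/
def ArboricityLE (G : SimpleGraph V) (c : ℕ) : Prop :=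
  ∃ F : Fin c → SimpleGraph V,
    (∀ i, (F i).IsAcyclic) ∧ (∀ i, F i ≤ G) ∧
      ∀ ⦃v w : V⦄, G.Adj v w → ∃ i, (F i).Adj v w

/-- `M` is the size of a maximum matching of `G`. -/
def MaxMatchingSize {V : Type*} (G : SimpleGraph V) (M : ℕ) : Prop :=
  (∃ H : G.Subgraph, H.IsMatching ∧ H.edgeSet.ncard = M) ∧
    ∀ H : G.Subgraph, H.IsMatching → H.edgeSet.ncard ≤ M

/-- `l` is a stream (an ordering) of the edges of `G`. -/
def IsEdgeStream (G : SimpleGraph V) (l : List (Sym2 V)) : Prop :=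
  l.Nodup ∧ ∀ e, e ∈ l ↔ e ∈ G.edgeSet

/-- `dAfter l i x`: the number of edges appearing strictly after position `i`
in the stream `l` that are incident to `x`; for a stream of pairwise distinct
simple-graph edges this is the number of neighbors of `x` appearing (as the
other endpoint of an edge at `x`) strictly after position `i`. -/
noncomputable def dAfter (l : List (Sym2 V)) (i : ℕ) (x : V) : ℕ :=
  {j : Fin l.length | i < (j : ℕ) ∧ x ∈ l.get j}.ncard

/-- The edge at position `i` of the stream `l` is `α`-good. -/
def AlphaGood (l : List (Sym2 V)) (α : ℝ) (i : Fin l.length) : Prop :=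
  ∀ x ∈ l.get i, (dAfter l (i : ℕ) x : ℝ) ≤ α

/-- The number of `α`-good edges of the stream `l` (the size of `E_α`). -/
noncomputable def EalphaCard (l : List (Sym2 V)) (α : ℝ) : ℕ :=
  {i : Fin l.length | AlphaGood l α i}.ncard

open Finset in
/-- A forest has at most as many edges as vertices. -/
theorem SimpleGraph.IsAcyclic.card_edgeFinset_le {W : Type*} [Fintype W] {H : SimpleGraph W}
    [Fintype H.edgeSet] (hH : H.IsAcyclic) : #H.edgeFinset ≤ Fintype.card W := by
  classical
  rcases isEmpty_or_nonempty W with hW | hW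
  · have : H.edgeFinset = ∅ := by
      ext e
      induction e with | _ a b => exact hW.elim a
    simp [this]
  · obtain ⟨T, hHT, -, hT⟩ :=
      (connected_top (V := W)).exists_isTree_le_of_le_of_isAcyclic le_top hH
    have h1 := hT.card_edgeFinset
    have h2 : #H.edgeFinset ≤ #T.edgeFinset := card_le_card (edgeFinset_mono hHT)
    lia

open Finset in
/-- A forest has at most `#s + #t` edges between disjoint sets `s` and `t`. -/
theorem SimpleGraph.IsAcyclic.sum_degree_between_le {V : Type*} [Fintype V] [DecidableEq V]
    {F : SimpleGraph V} {s t : Finset V} [DecidableRel (F.between (s : Set V) t).Adj]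
    (hF : F.IsAcyclic) (hst : Disjoint s t) :
    ∑ v ∈ s, (F.between (s : Set V) t).degree v ≤ #s + #t := by
  have hb : (F.between (s : Set V) t).IsBipartiteWith s t :=
    between_isBipartiteWith (by exact_mod_cast hst)
  rw [isBipartiteWith_sum_degrees_eq_card_edges hb]
  have hsupp : (F.between (s : Set V) t).support ⊆ ((s ∪ t : Finset V) : Set V) := by
    simpa using isBipartiteWith_support_subset hb
  have hacyc : (F.between (s : Set V) t).IsAcyclic := hF.anti between_le
  have hforest := (hacyc.induce ((s ∪ t : Finset V) : Set V)).card_edgeFinset_le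
  have hcard := card_edgeFinset_induce_of_support_subset hsupp
  refine (by convert hcard.ge : _ ≤ _).trans (hforest.trans ?_)
  simpa using card_union_le s t

/-- A matching covers at most twice as many vertices as it has edges. -/
theorem SimpleGraph.Subgraph.IsMatching.ncard_verts_le {V : Type*} [Finite V] {G : SimpleGraph V}
    {H : G.Subgraph} (hH : H.IsMatching) : H.verts.ncard ≤ 2 * H.edgeSet.ncard := by
  classical
  have hfin := H.edgeSet.toFinite
  have hverts : H.verts = (hfin.toFinset.biUnion Sym2.toFinset : Finset V) := by
    rw [hH.verts_eq_biUnion_edgeSet]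
    ext v
    simp
  rw [hverts, Set.ncard_coe_finset, Set.ncard_eq_toFinset_card _ hfin, mul_comm]
  refine Finset.card_biUnion_le_card_mul _ _ _ fun e _ ↦ ?_
  rw [Sym2.card_toFinset]
  split_ifs <;> simp

/-- The vertices of a maximum matching cover every edge. -/
theorem SimpleGraph.Subgraph.IsMatching.mem_verts_or_mem_verts {V : Type*} [Finite V]
    {G : SimpleGraph V} {H : G.Subgraph} (hH : H.IsMatching)
    (hmax : ∀ H' : G.Subgraph, H'.IsMatching → H'.edgeSet.ncard ≤ H.edgeSet.ncard)
    {v w : V} (hvw : G.Adj v w) : v ∈ H.verts ∨ w ∈ H.verts := by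
  by_contra! hcon
  have hS := IsMatching.subgraphOfAdj hvw
  have hsup : (H ⊔ G.subgraphOfAdj hvw).IsMatching := by
    refine hH.sup hS ?_
    rw [hH.support_eq_verts, hS.support_eq_verts, Set.disjoint_right]
    rintro x (rfl | rfl)
    exacts [hcon.1, hcon.2]
  have hlt : H.edgeSet ⊂ (H ⊔ G.subgraphOfAdj hvw).edgeSet := by
    refine ⟨edgeSet_mono le_sup_left, fun hle ↦ hcon.1 ?_⟩
    have : s(v, w) ∈ H.edgeSet := hle (by simp)
    exact H.edge_vert this
  exact (Set.ncard_lt_ncard hlt (Set.toFinite _)).not_ge (hmax _ hsup)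

open Finset in
/-- If all edges at vertices of `s` lead to the disjoint set `t`, then the degrees over `s` sum
to at most `c * (#s + #t)` in a graph of arboricity at most `c`. -/
theorem ArboricityLE.sum_degree_le {V : Type*} [Fintype V] {G : SimpleGraph V}
    [DecidableRel G.Adj] {c : ℕ} (harb : ArboricityLE G c) {s t : Finset V} (hst : Disjoint s t)
    (hadj : ∀ v ∈ s, ∀ w, G.Adj v w → w ∈ t) :
    ∑ v ∈ s, G.degree v ≤ c * (#s + #t) := by
  classical
  obtain ⟨F, hF, -, hcov⟩ := harb
  have hdeg : ∀ v ∈ s, G.degree v ≤ ∑ i, ((F i).between (s : Set V) t).degree v := by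
    intro v hv
    refine (card_le_card fun w hw ↦ ?_).trans
      (card_biUnion_le (s := univ)
        (t := fun i ↦ ((F i).between (s : Set V) t).neighborFinset v))
    have hvw : G.Adj v w := by simpa using hw
    obtain ⟨i, hi⟩ := hcov hvw
    simp only [mem_biUnion, mem_univ, true_and, mem_neighborFinset, between_adj, mem_coe]
    exact ⟨i, hi, .inl ⟨hv, hadj v hv w hvw⟩⟩
  calc ∑ v ∈ s, G.degree v ≤ ∑ v ∈ s, ∑ i, ((F i).between (s : Set V) t).degree v :=
        sum_le_sum hdeg
    _ = ∑ i, ∑ v ∈ s, ((F i).between (s : Set V) t).degree v := sum_comm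
    _ ≤ ∑ _i : Fin c, (#s + #t) := sum_le_sum fun i _ ↦ (hF i).sum_degree_between_le hst
    _ = c * (#s + #t) := by simp

theorem statement_0 {V : Type*} [Fintype V] (G : SimpleGraph V) [DecidableRel G.Adj]
    (c μ M : ℕ) (harb : ArboricityLE G c) (hμ : 2 * c < μ)
    (hM : MaxMatchingSize G M) :
    ({v : V | μ < G.degree v}.ncard : ℝ) ≤ 2 * μ / (μ - 2 * c + 1) * M := by
  classical
  have hμ' : (2 * c + 1 : ℝ) ≤ μ := by exact_mod_cast hμ
  have hpos : (0 : ℝ) < μ - 2 * c + 1 := by linarith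
  rcases Nat.eq_zero_or_pos c with rfl | hc
  · have hempty : {v : V | μ < G.degree v} = ∅ := by
      obtain ⟨F, -, -, hcov⟩ := harb
      refine Set.eq_empty_of_forall_notMem fun v hv ↦ ?_
      obtain ⟨w, hw⟩ := (G.degree_pos_iff_exists_adj v).1 (Nat.zero_lt_of_lt hv)
      exact (hcov hw).choose.elim0
    simp only [hempty, Set.ncard_empty, Nat.cast_zero] at hpos ⊢
    exact mul_nonneg (div_nonneg (by positivity) hpos.le) (Nat.cast_nonneg _)
  obtain ⟨⟨H, hH, rfl⟩, hmax⟩ := hM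
  set t : Finset V := H.verts.toFinset with ht
  set s : Finset V := {v | μ < G.degree v ∧ v ∉ t} with hs
  have hst : Disjoint s t := by
    rw [Finset.disjoint_left]
    intro v hv
    exact (Finset.mem_filter.1 hv).2.2
  have hadj : ∀ v ∈ s, ∀ w, G.Adj v w → w ∈ t := by
    intro v hv w hvw
    have hvt := (Finset.mem_filter.1 hv).2.2
    simp only [ht, Set.mem_toFinset] at hvt ⊢
    exact (hH.mem_verts_or_mem_verts hmax hvw).resolve_left hvt
  have hupper := harb.sum_degree_le hst hadj
  have hlower : s.card * (μ + 1) ≤ ∑ v ∈ s, G.degree v := by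
    rw [← smul_eq_mul]
    exact Finset.card_nsmul_le_sum _ _ _ fun v hv ↦ (Finset.mem_filter.1 hv).2.1
  have htcard : t.card ≤ 2 * H.edgeSet.ncard := by
    rw [ht, ← Set.ncard_eq_toFinset_card']
    exact hH.ncard_verts_le
  have hheavy : {v : V | μ < G.degree v}.ncard ≤ s.card + t.card := by
    refine le_trans ?_ (Finset.card_union_le s t)
    rw [← Set.ncard_coe_finset]
    refine Set.ncard_le_ncard (fun v hv ↦ ?_) (Set.toFinite _)
    have hv' : μ < G.degree v := hv
    by_cases hvt : v ∈ t <;> simp [hs, hvt, hv']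
  have hcount : (s.card * (μ + 1) : ℝ) ≤ c * (s.card + t.card) := by
    exact_mod_cast hlower.trans hupper
  have htcard' : (t.card : ℝ) ≤ 2 * H.edgeSet.ncard := by exact_mod_cast htcard
  have hheavy' : ({v : V | μ < G.degree v}.ncard : ℝ) ≤ s.card + t.card := by
    exact_mod_cast hheavy
  have hc' : (1 : ℝ) ≤ c := by exact_mod_cast hc
  have hs0 : (0 : ℝ) ≤ s.card := Nat.cast_nonneg _
  have ht0 : (0 : ℝ) ≤ t.card := Nat.cast_nonneg _
  rw [div_mul_eq_mul_div, le_div_iff₀ hpos]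
  calc ({v : V | μ < G.degree v}.ncard : ℝ) * (μ - 2 * c + 1)
      ≤ (s.card + t.card) * (μ - 2 * c + 1) := by gcongr
    _ ≤ μ * t.card := by
        nlinarith [mul_nonneg hs0 (zero_le_one.trans hc'), mul_nonneg ht0 (sub_nonneg.2 hc')]
    _ ≤ μ * (2 * H.edgeSet.ncard) := by gcongr
    _ = 2 * μ * H.edgeSet.ncard := by ring
end

section
/- Let G = (V,E) be a finite simple graph, let M* be the size of a maximum matching of G, let μ be a positive integer, let h_μ be the number of vertices of degree greater than μ, and let M_μ be the size of a maximum matching of the subgraph of G induced on the vertices of degree at most μ. Then M* ≤ h_μ + M_μ. -/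
open SimpleGraph

variable {V : Type*}

/-- The edges of a matching that avoid the complement of `s` form a matching of `G.induce s`. -/
theorem SimpleGraph.Subgraph.IsMatching.exists_induce_ncard_le {V : Type*} [Finite V]
    {G : SimpleGraph V} {H : G.Subgraph} (hH : H.IsMatching) (s : Set V) :
    ∃ K : (G.induce s).Subgraph, K.IsMatching ∧
      H.edgeSet.ncard ≤ sᶜ.ncard + K.edgeSet.ncard := by
  have unique : ∀ {u v w}, H.Adj u v → H.Adj u w → v = w := fun h₁ h₂ =>
    (hH (H.edge_vert h₁)).unique h₁ h₂
  let K : (G.induce s).Subgraph :=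
    { verts := {v | ∃ w : s, H.Adj v w}
      Adj := fun v w => H.Adj v w
      adj_sub := fun h => H.adj_sub h
      edge_vert := fun h => ⟨_, h⟩
      symm := ⟨fun _ _ h => H.adj_symm h⟩ }
  refine ⟨K, ?_, ?_⟩
  · rintro v ⟨w, hw⟩
    exact ⟨w, hw, fun y hy => Subtype.ext (unique hy hw)⟩
  · have partner : ∀ v, ∃ e : Sym2 V, ∀ w, H.Adj v w → s(v, w) = e := by
      intro v
      by_cases h : ∃ w, H.Adj v w
      · obtain ⟨w, hw⟩ := h
        exact ⟨s(v, w), fun y hy => by rw [unique hy hw]⟩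
      · exact ⟨s(v, v), fun y hy => (h ⟨y, hy⟩).elim⟩
    choose f hf using partner
    have cover : H.edgeSet ⊆ f '' sᶜ ∪ Sym2.map Subtype.val '' K.edgeSet := by
      intro e
      induction e with
      | _ v w =>
        intro h
        have hvw : H.Adj v w := h
        by_cases hv : v ∈ s
        · by_cases hw : w ∈ s
          · exact Or.inr ⟨s(⟨v, hv⟩, ⟨w, hw⟩), hvw, rfl⟩
          · exact Or.inl ⟨w, hw, by rw [← hf w v hvw.symm, Sym2.eq_swap]⟩
        · exact Or.inl ⟨v, hv, (hf v w hvw).symm⟩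
    calc H.edgeSet.ncard ≤ (f '' sᶜ ∪ Sym2.map Subtype.val '' K.edgeSet).ncard :=
          Set.ncard_le_ncard cover (Set.toFinite _)
      _ ≤ (f '' sᶜ).ncard + (Sym2.map Subtype.val '' K.edgeSet).ncard := Set.ncard_union_le _ _
      _ ≤ sᶜ.ncard + K.edgeSet.ncard :=
          add_le_add (Set.ncard_image_le (Set.toFinite _)) (Set.ncard_image_le (Set.toFinite _))

theorem statement_1 {V : Type*} [Fintype V] (G : SimpleGraph V) [DecidableRel G.Adj]
    (μ Mstar Mμ : ℕ) (hμ : 0 < μ)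
    (hMstar : MaxMatchingSize G Mstar)
    (hMμ : MaxMatchingSize (G.induce {v : V | G.degree v ≤ μ}) Mμ) :
    Mstar ≤ {v : V | μ < G.degree v}.ncard + Mμ := by
  obtain ⟨⟨H, hH, rfl⟩, -⟩ := hMstar
  obtain ⟨K, hK, hle⟩ := hH.exists_induce_ncard_le {v : V | G.degree v ≤ μ}
  have compl_eq : {v : V | G.degree v ≤ μ}ᶜ = {v : V | μ < G.degree v} := by
    ext v
    simp
  rw [compl_eq] at hle
  exact hle.trans (Nat.add_le_add_left (hMμ.2 K hK) _)
end

section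
/- Let G = (V,E) be a finite simple graph with arboricity at most c, let M* be the size of a maximum matching of G, let μ > 2c be an integer, let h_μ be the number of vertices of degree greater than μ, and let M_μ be the size of a maximum matching of the subgraph induced on vertices of degree at most μ. Then h_μ + M_μ ≤ (2μ/(μ − 2c + 1) + 1)·M*. -/
open SimpleGraph

variable {V : Type*}

namespace SimpleGraph

/-- A forest has at most as many edges as vertices. -/
lemma IsAcyclic.card_edgeFinset_le_s2 {W : Type*} [Fintype W] {F : SimpleGraph W} [Fintype F.edgeSet]
    (hF : F.IsAcyclic) : F.edgeFinset.card ≤ Fintype.card W := by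
  classical
  cases isEmpty_or_nonempty W
  · simp [Subsingleton.elim F ⊥]
  obtain ⟨T, hFT, -, hT⟩ := connected_top.exists_isTree_le_of_le_of_isAcyclic le_top hF
  have hcard := hT.card_edgeFinset
  have hle : F.edgeFinset.card ≤ T.edgeFinset.card := Finset.card_le_card (by simpa using hFT)
  omega

/-- The number of edges of a forest between disjoint sets `A` and `T` is at most `|A| + |T|`. -/
lemma IsAcyclic.sum_degree_between_le_s2 {W : Type*} [Fintype W] [DecidableEq W]
    {F : SimpleGraph W} [DecidableRel F.Adj] (hF : F.IsAcyclic) {A T : Finset W}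
    (hAT : Disjoint A T) :
    ∑ a ∈ A, (F.neighborFinset a ∩ T).card ≤ A.card + T.card := by
  classical
  set B := F.between (A : Set W) (T : Set W)
  have hbip : B.IsBipartiteWith (A : Set W) (T : Set W) :=
    between_isBipartiteWith (Finset.disjoint_coe.mpr hAT)
  have hsupp : B.support ⊆ ((A ∪ T : Finset W) : Set W) := by
    rintro v ⟨w, -, h | h⟩ <;> simp_all
  have hind := ((hF.anti between_le : B.IsAcyclic).induce
    ((A ∪ T : Finset W) : Set W)).card_edgeFinset_le_s2
  have hedges := card_edgeFinset_induce_of_support_subset hsupp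
  calc ∑ a ∈ A, (F.neighborFinset a ∩ T).card
      ≤ ∑ a ∈ A, B.degree a := by
        refine Finset.sum_le_sum fun a ha ↦ Finset.card_le_card fun w hw ↦ ?_
        simp only [Finset.mem_inter, mem_neighborFinset] at hw ⊢
        exact ⟨hw.1, .inl ⟨ha, hw.2⟩⟩
    _ = B.edgeFinset.card := isBipartiteWith_sum_degrees_eq_card_edges hbip
    _ ≤ (A ∪ T).card := by
        rw [← Set.toFinset_card, Finset.toFinset_coe] at hind
        rw [← hedges]
        convert hind
    _ ≤ A.card + T.card := Finset.card_union_le _ _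

lemma Subgraph.IsMatching.ncard_verts_le_s2 {W : Type*} [Finite W] {G : SimpleGraph W}
    {M : G.Subgraph} (hM : M.IsMatching) : M.verts.ncard ≤ 2 * M.edgeSet.ncard := by
  classical
  rw [hM.verts_eq_biUnion_edgeSet]
  have hfin : M.edgeSet.Finite := Set.toFinite _
  have hunion := hfin.toFinset.set_ncard_biUnion_le fun e ↦ (e : Set W)
  have hsum := Finset.sum_le_card_nsmul hfin.toFinset (fun e ↦ (e : Set W).ncard) 2 fun e _ ↦ by
    rw [show (e : Set W) = (e.toFinset : Set W) by ext; simp, Set.ncard_coe_finset, Sym2.card_toFinset]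
    split_ifs <;> omega
  rw [← Set.ncard_eq_toFinset_card _ hfin] at hsum
  simp only [Set.Finite.mem_toFinset, smul_eq_mul] at hunion hsum
  omega

end SimpleGraph

lemma MaxMatchingSize.le_of_embedding {W W' : Type*} [Finite W'] {G : SimpleGraph W}
    {G' : SimpleGraph W'} (f : G ↪g G') {m m' : ℕ} (hm : MaxMatchingSize G m)
    (hm' : MaxMatchingSize G' m') : m ≤ m' := by
  obtain ⟨H, hH, rfl⟩ := hm.1
  have hle := hm'.2 _ (hH.map f.toHom f.injective)
  rwa [Subgraph.edgeSet_map,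
    Set.ncard_image_of_injective _ (f := Sym2.map f.toHom) (Sym2.map.injective f.injective)] at hle

/-- The vertices missed by a maximum matching form an independent set. -/
lemma SimpleGraph.Subgraph.IsMatching.mem_verts_or_mem_verts_s2 {W : Type*} [Finite W]
    {G : SimpleGraph W} {M : G.Subgraph} (hM : M.IsMatching)
    (hmax : ∀ H : G.Subgraph, H.IsMatching → H.edgeSet.ncard ≤ M.edgeSet.ncard) {a b : W}
    (hab : G.Adj a b) : a ∈ M.verts ∨ b ∈ M.verts := by
  by_contra! h
  have hle := hmax _ (hM.sup (.subgraphOfAdj hab) (by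
    rw [hM.support_eq_verts, support_subgraphOfAdj, Set.disjoint_right]
    rintro x (rfl | rfl)
    exacts [h.1, h.2]))
  have hnot : s(a, b) ∉ M.edgeSet := fun he ↦ h.1 (M.edge_vert he)
  rw [Subgraph.edgeSet_sup, edgeSet_subgraphOfAdj, Set.union_singleton,
    Set.ncard_insert_of_notMem hnot (Set.toFinite _)] at hle
  omega

/-- If all neighbours of vertices of `A` lie in `T`, disjoint from `A`, then an arboricity bound
limits the degree sum over `A`. -/
lemma ArboricityLE.sum_degree_le_s2 {W : Type*} [Fintype W] {G : SimpleGraph W}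
    [DecidableRel G.Adj] {c : ℕ} (h : ArboricityLE G c) {A T : Finset W} (hAT : Disjoint A T)
    (hN : ∀ a ∈ A, ∀ b, G.Adj a b → b ∈ T) :
    ∑ a ∈ A, G.degree a ≤ c * (A.card + T.card) := by
  classical
  obtain ⟨F, hF, -, hcov⟩ := h
  calc ∑ a ∈ A, G.degree a
      ≤ ∑ a ∈ A, ∑ i, ((F i).neighborFinset a ∩ T).card := by
        refine Finset.sum_le_sum fun a ha ↦
          (Finset.card_le_card fun b hb ↦ ?_).trans Finset.card_biUnion_le
        rw [mem_neighborFinset] at hb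
        obtain ⟨i, hi⟩ := hcov hb
        simpa [hN a ha b hb] using ⟨i, hi⟩
    _ = ∑ i, ∑ a ∈ A, ((F i).neighborFinset a ∩ T).card := Finset.sum_comm
    _ ≤ ∑ _i : Fin c, (A.card + T.card) :=
        Finset.sum_le_sum fun i _ ↦ (hF i).sum_degree_between_le_s2 hAT
    _ = c * (A.card + T.card) := by simp

theorem statement_2 {V : Type*} [Fintype V] (G : SimpleGraph V) [DecidableRel G.Adj]
    (c μ Mstar Mμ : ℕ) (harb : ArboricityLE G c) (hμ : 2 * c < μ)
    (hMstar : MaxMatchingSize G Mstar)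
    (hMμ : MaxMatchingSize (G.induce {v : V | G.degree v ≤ μ}) Mμ) :
    ({v : V | μ < G.degree v}.ncard + Mμ : ℝ) ≤
      (2 * μ / (μ - 2 * c + 1) + 1) * Mstar := by
  classical
  have hMM : Mμ ≤ Mstar := hMμ.le_of_embedding (Embedding.induce _) hMstar
  obtain ⟨⟨H, hH, rfl⟩, hmax⟩ := hMstar
  have hverts := hH.ncard_verts_le_s2
  set M := H.edgeSet.ncard
  set T := H.verts.toFinset with hT
  have hTcard : T.card ≤ 2 * M := by rwa [hT, ← Set.ncard_eq_toFinset_card']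
  set S := {v : V | μ < G.degree v}
  set A := S.toFinset \ T with hA
  have hSA : S.ncard ≤ A.card + T.card := by
    rw [Set.ncard_eq_toFinset_card', hA]
    exact Finset.card_le_card_sdiff_add_card
  have hsum : ∑ a ∈ A, G.degree a ≤ c * (A.card + T.card) := by
    refine harb.sum_degree_le_s2 Finset.sdiff_disjoint fun a ha b hab ↦ ?_
    have haT : a ∉ T := (Finset.mem_sdiff.mp ha).2
    have hor := hH.mem_verts_or_mem_verts_s2 hmax hab
    rw [hT, Set.mem_toFinset] at haT ⊢
    exact hor.resolve_left haT
  have hlow : A.card * (μ + 1) ≤ ∑ a ∈ A, G.degree a :=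
    Finset.card_nsmul_le_sum A _ (μ + 1) fun a ha ↦
      (Set.mem_toFinset.mp (Finset.mem_sdiff.mp ha).1 : a ∈ S)
  have hD : (0 : ℝ) < μ - 2 * c + 1 := by
    have : (2 * c : ℝ) < μ := mod_cast hμ
    linarith
  have hS : (S.ncard : ℝ) ≤ 2 * μ / (μ - 2 * c + 1) * M := by
    rcases Nat.eq_zero_or_pos c with rfl | hc
    · have hS0 : S = ∅ := by
        refine Set.eq_empty_of_forall_notMem fun v (hv : μ < G.degree v) ↦ ?_
        obtain ⟨w, hw⟩ := (G.degree_pos_iff_exists_adj v).mp (by omega)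
        obtain ⟨F, -, -, hcov⟩ := harb
        exact (hcov hw).choose.elim0
      rw [hS0, Set.ncard_empty, Nat.cast_zero]
      exact mul_nonneg (div_nonneg (by positivity) (mod_cast hD.le)) (Nat.cast_nonneg M)
    · have hAc : (A.card * (μ + 1) : ℝ) ≤ c * (A.card + 2 * M) := by
        exact_mod_cast (hlow.trans hsum).trans (by gcongr)
      have hSc : (S.ncard : ℝ) ≤ A.card + 2 * M := by
        exact_mod_cast hSA.trans (by gcongr)
      have hc' : (1 : ℝ) ≤ c := mod_cast hc
      rw [div_mul_eq_mul_div, le_div_iff₀ hD]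
      nlinarith [mul_le_mul_of_nonneg_right hSc hD.le,
        mul_nonneg (sub_nonneg.mpr hc') (Nat.cast_nonneg (α := ℝ) M),
        mul_nonneg (Nat.cast_nonneg (α := ℝ) c) (Nat.cast_nonneg (α := ℝ) A.card)]
  have hMM' : (Mμ : ℝ) ≤ M := mod_cast hMM
  linarith [add_mul (2 * μ / (μ - 2 * c + 1) : ℝ) 1 M]
end

section
/- Let S = (e_1, …, e_m) be any ordering (stream) of the edges of a finite simple graph G with arboricity at most c, let M* be the size of a maximum matching of G, let μ > 2c be an integer, let α = max{μ − 1, 4c(μ+1)/(μ+1−2c)}, and let E_α be the set of α-good edges of S. Then (1/2 − c/(μ+1))·M* ≤ |E_α|. -/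
open SimpleGraph

variable {V : Type*}

/-- A forest on finitely many vertices has at most as many edges as vertices. -/
theorem SimpleGraph.IsAcyclic.ncard_edgeSet_le {W : Type*} [Finite W] {F : SimpleGraph W}
    (hF : F.IsAcyclic) : F.edgeSet.ncard ≤ Nat.card W := by
  rcases isEmpty_or_nonempty W with h | h
  · rw [Set.eq_empty_of_isEmpty F.edgeSet, Set.ncard_empty]
    exact Nat.zero_le _
  · obtain ⟨T, hFT, -, hT⟩ :=
      connected_top.exists_isTree_le_of_le_of_isAcyclic (le_top : F ≤ ⊤) hF
    have h1 := (isTree_iff_connected_and_card.mp hT).2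
    rw [Nat.card_coe_set_eq] at h1
    have h2 : F.edgeSet.ncard ≤ T.edgeSet.ncard :=
      Set.ncard_le_ncard (edgeSet_mono hFT) (Set.toFinite _)
    omega

/-- A forest spans at most `#H` edges inside a vertex set `H`. -/
theorem SimpleGraph.IsAcyclic.ncard_edges_within_le [Finite V] {F : SimpleGraph V}
    (hF : F.IsAcyclic) (H : Finset V) :
    {e ∈ F.edgeSet | ∀ x ∈ e, x ∈ H}.ncard ≤ H.card := by
  have h1 := (hF.induce (H : Set V)).ncard_edgeSet_le
  rw [Nat.card_coe_set_eq, Set.ncard_coe_finset] at h1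
  refine le_trans (le_trans (Set.ncard_le_ncard (t := Sym2.map Subtype.val ''
    (F.induce (H : Set V)).edgeSet) ?_ (Set.toFinite _)) (Set.ncard_image_le (Set.toFinite _))) h1
  rintro e
  induction e with
  | _ u v =>
    rintro ⟨huv, hH⟩
    exact ⟨s(⟨u, hH u (by simp)⟩, ⟨v, hH v (by simp)⟩), by simpa using huv, by simp⟩

/-- A graph of arboricity at most `c` spans at most `c * #H` edges inside a vertex set `H`. -/
theorem ArboricityLE.ncard_edges_within_le [Finite V] {G : SimpleGraph V} {c : ℕ}
    (hG : ArboricityLE G c) (H : Finset V) :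
    {e ∈ G.edgeSet | ∀ x ∈ e, x ∈ H}.ncard ≤ c * H.card := by
  obtain ⟨F, hF, -, hcov⟩ := hG
  have hsub : {e ∈ G.edgeSet | ∀ x ∈ e, x ∈ H} ⊆
      ⋃ i, {e ∈ (F i).edgeSet | ∀ x ∈ e, x ∈ H} := by
    rintro e
    induction e with
    | _ u v =>
      rintro ⟨huv, hH⟩
      obtain ⟨i, hi⟩ := hcov huv
      exact Set.mem_iUnion.2 ⟨i, hi, hH⟩
  calc _ ≤ _ := Set.ncard_le_ncard hsub (Set.toFinite _)
    _ ≤ ∑ i, {e ∈ (F i).edgeSet | ∀ x ∈ e, x ∈ H}.ncard := by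
      simpa using Set.ncard_iUnion_le_of_fintype fun i => {e ∈ (F i).edgeSet | ∀ x ∈ e, x ∈ H}
    _ ≤ ∑ _i : Fin c, H.card := Finset.sum_le_sum fun i _ => (hF i).ncard_edges_within_le H
    _ = c * H.card := by simp

/-- A finite set with at least `m` elements has at least `m` elements that are followed by fewer
than `m` others. -/
theorem Finset.le_card_filter_card_gt_lt {ι : Type*} [LinearOrder ι] (s : Finset ι) {m : ℕ}
    (hm : m ≤ s.card) : m ≤ (s.filter fun i => (s.filter fun j => i < j).card < m).card := by
  rcases (s.filter fun i => m ≤ (s.filter fun j => i < j).card).eq_empty_or_nonempty with h | h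
  · rwa [Finset.filter_true_of_mem]
    intro i hi
    by_contra hlt
    exact Finset.notMem_empty i (h ▸ Finset.mem_filter.2 ⟨hi, not_lt.1 hlt⟩)
  · obtain ⟨hi, hle⟩ := Finset.mem_filter.1 (Finset.max'_mem _ h)
    refine hle.trans (Finset.card_le_card fun j hj => ?_)
    obtain ⟨hjs, hij⟩ := Finset.mem_filter.1 hj
    refine Finset.mem_filter.2 ⟨hjs, not_le.1 fun hjm => ?_⟩
    exact absurd (Finset.le_max' _ j (Finset.mem_filter.2 ⟨hjs, hjm⟩)) (not_le.2 hij)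

/-- If `H` meets every edge of a matching outside an edge set `S`, the matching has at most
`#H + #S` edges. -/
theorem SimpleGraph.Subgraph.IsMatching.ncard_edgeSet_le [Finite V] {G : SimpleGraph V}
    {K : G.Subgraph} (hK : K.IsMatching) (H : Finset V) (S : Set (Sym2 V))
    (hS : ∀ e ∈ K.edgeSet, (∀ x ∈ e, x ∉ H) → e ∈ S) :
    K.edgeSet.ncard ≤ H.card + S.ncard := by
  classical
  have hsub : K.edgeSet ⊆ {e ∈ K.edgeSet | ∃ x ∈ e, x ∈ H} ∪ S := fun e he => by
    by_cases h : ∃ x ∈ e, x ∈ H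
    · exact Or.inl ⟨he, h⟩
    · exact Or.inr (hS e he fun x hx hxH => h ⟨x, hx, hxH⟩)
  refine (Set.ncard_le_ncard hsub (Set.toFinite _)).trans ((Set.ncard_union_le _ _).trans ?_)
  refine Nat.add_le_add_right ?_ _
  rw [← Set.ncard_coe_finset H]
  rcases isEmpty_or_nonempty V with hV | hV
  · simp
  have hex : ∀ e ∈ {e ∈ K.edgeSet | ∃ x ∈ e, x ∈ H}, ∃ x ∈ e, x ∈ H := fun e he => he.2
  choose! f hfe hfH using hex
  refine Set.ncard_le_ncard_of_injOn f (fun e he => hfH e he) ?_ (Set.toFinite _)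
  intro e he e' he' heq
  have h1 := hfe e he
  have h2 := hfe e' he'
  rw [← heq] at h2
  obtain ⟨w, hw⟩ := Sym2.mem_iff_exists.1 h1
  obtain ⟨w', hw'⟩ := Sym2.mem_iff_exists.1 h2
  have hA : K.Adj (f e) w := by rw [← Subgraph.mem_edgeSet, ← hw]; exact he.1
  have hA' : K.Adj (f e) w' := by rw [← Subgraph.mem_edgeSet, ← hw']; exact he'.1
  rw [hw, hw', hK.eq_of_adj_left hA hA']

/-- If each `v ∈ H` owns at least `m` elements, no element has more than two owners, and elements
outside `B` have at most one owner, then `m * #H ≤ #(elements outside B) + 2 * #B`. -/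
theorem Finset.mul_card_le_card_biUnion_sdiff_add {ι : Type*} [DecidableEq ι] [DecidableEq V]
    (H : Finset V) (T : V → Finset ι) (B : Finset ι) {m : ℕ} (hm : ∀ v ∈ H, m ≤ (T v).card)
    (h2 : ∀ i ∈ B, (H.filter fun v => i ∈ T v).card ≤ 2)
    (h1 : ∀ v ∈ H, ∀ w ∈ H, ∀ i, i ∈ T v → i ∈ T w → i ∉ B → v = w) :
    m * H.card ≤ (H.biUnion fun v => T v \ B).card + 2 * B.card := by
  have hdisj : (H : Set V).PairwiseDisjoint fun v => T v \ B := by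
    intro v hv w hw hvw
    refine Finset.disjoint_left.2 fun i hi hi' => hvw ?_
    rw [Finset.mem_sdiff] at hi hi'
    exact h1 v hv w hw i hi.1 hi'.1 hi.2
  have hB : ∑ v ∈ H, (B.filter fun i => i ∈ T v).card ≤ 2 * B.card := by
    have := Finset.sum_card_bipartiteAbove_eq_sum_card_bipartiteBelow (s := H) (t := B)
      (fun v i => i ∈ T v)
    simp only [Finset.bipartiteAbove, Finset.bipartiteBelow] at this
    rw [this, mul_comm]
    exact Finset.sum_le_card_nsmul _ _ _ h2
  have hT : ∀ v ∈ H, m ≤ (T v \ B).card + (B.filter fun i => i ∈ T v).card := by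
    intro v hv
    rw [Finset.filter_mem_eq_inter, Finset.inter_comm, Finset.card_sdiff_add_card_inter]
    exact hm v hv
  have := Finset.card_nsmul_le_sum _ _ _ hT
  rw [Finset.sum_add_distrib, ← Finset.card_biUnion hdisj, smul_eq_mul, mul_comm] at this
  omega

open Classical in
/-- The maximum matching is at most the number of `α`-good edges as soon as `μ - 1 ≤ α`. -/
theorem MaxMatchingSize.le_EalphaCard [Fintype V] {G : SimpleGraph V} {c μ M : ℕ}
    {l : List (Sym2 V)} (hstream : IsEdgeStream G l) (harb : ArboricityLE G c) (hμ : 2 * c < μ)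
    (hM : MaxMatchingSize G M) {α : ℝ} (hα : (μ : ℝ) - 1 ≤ α) : M ≤ EalphaCard l α := by
  obtain ⟨⟨K, hK, rfl⟩, -⟩ := hM
  have hinj : Function.Injective l.get := List.nodup_iff_injective_get.1 hstream.1
  let D : V → Finset (Fin l.length) := fun v => {j | v ∈ l.get j}
  let H : Finset V := {v | μ < (D v).card}
  let T : V → Finset (Fin l.length) := fun v =>
    (D v).filter fun i => ((D v).filter fun j => i < j).card < μ
  let B : Finset (Fin l.length) := {i | ∀ x ∈ l.get i, x ∈ H}
  let S : Finset (Fin l.length) := {i | ∀ x ∈ l.get i, x ∉ H}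
  let U : Finset (Fin l.length) := H.biUnion fun v => T v \ B
  have hd : ∀ i v, dAfter l (i : Fin l.length) v = ((D v).filter fun j => i < j).card := by
    intro i v
    rw [dAfter, ← Set.ncard_coe_finset]
    congr 1
    ext j
    simp [D, and_comm]
  have hlt : ∀ (i : Fin l.length) v, dAfter l i v < μ → (dAfter l i v : ℝ) ≤ α := by
    intro i v h
    have : (dAfter l i v : ℝ) + 1 ≤ μ := by exact_mod_cast h
    linarith
  have hlight : ∀ i v, v ∈ l.get i → v ∉ H → dAfter l i v < μ := by
    intro i v hv hvH
    have h1 : (D v).card ≤ μ := by simpa [H] using hvH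
    rw [hd]
    refine lt_of_lt_of_le (Finset.card_lt_card ?_) h1
    exact Finset.filter_ssubset.2 ⟨i, by simpa [D] using hv, lt_irrefl i⟩
  have hTD : ∀ i v, i ∈ T v → v ∈ l.get i := by
    intro i v h
    simpa [D] using (Finset.mem_filter.1 h).1
  have hpair : ∀ v ∈ H, ∀ w ∈ H, ∀ i, i ∈ T v → i ∈ T w → i ∉ B → v = w := by
    intro v hv w hw i hiv hiw hiB
    by_contra hne
    refine hiB (Finset.mem_filter.2 ⟨Finset.mem_univ _, fun x hx => ?_⟩)
    rw [(Sym2.mem_and_mem_iff hne).1 ⟨hTD i v hiv, hTD i w hiw⟩, Sym2.mem_iff] at hx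
    rcases hx with rfl | rfl <;> assumption
  have htwo : ∀ i ∈ B, (H.filter fun v => i ∈ T v).card ≤ 2 := by
    intro i _
    refine (Finset.card_le_card (t := (l.get i).toFinset) fun v hv => ?_).trans ?_
    · exact Sym2.mem_toFinset.2 (hTD i v (Finset.mem_filter.1 hv).2)
    · rw [Sym2.card_toFinset]; split_ifs <;> simp
  have hcount : μ * H.card ≤ U.card + 2 * B.card :=
    Finset.mul_card_le_card_biUnion_sdiff_add H T B
      (fun v hv => Finset.le_card_filter_card_gt_lt _ (Finset.mem_filter.1 hv).2.le) htwo hpair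
  have hBcard : B.card ≤ c * H.card := by
    refine le_trans ?_ (harb.ncard_edges_within_le H)
    rw [← Set.ncard_coe_finset]
    refine Set.ncard_le_ncard_of_injOn l.get (fun i hi => ⟨?_, ?_⟩) hinj.injOn (Set.toFinite _)
    · exact (hstream.2 _).1 (List.get_mem l i)
    · exact (Finset.mem_filter.1 hi).2
  have hKcard : K.edgeSet.ncard ≤ H.card + S.card := by
    rw [← Set.ncard_coe_finset S, ← Set.ncard_image_of_injective _ hinj]
    refine hK.ncard_edgeSet_le H _ fun e he heH => ?_
    obtain ⟨i, rfl⟩ := List.mem_iff_get.1 ((hstream.2 e).2 (K.edgeSet_subset he))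
    exact ⟨i, by simpa [S] using heH, rfl⟩
  have hUS : Disjoint U S := by
    refine Finset.disjoint_left.2 fun i hiU hiS => ?_
    obtain ⟨v, hv, hi⟩ := Finset.mem_biUnion.1 hiU
    exact (Finset.mem_filter.1 hiS).2 v (hTD i v (Finset.mem_sdiff.1 hi).1) hv
  have hgood : U.card + S.card ≤ EalphaCard l α := by
    rw [← Finset.card_union_of_disjoint hUS, EalphaCard, ← Set.ncard_coe_finset]
    refine Set.ncard_le_ncard (fun i hi => ?_) (Set.toFinite _)
    rcases Finset.mem_union.1 hi with hiU | hiS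
    · obtain ⟨v, hv, hi⟩ := Finset.mem_biUnion.1 hiU
      obtain ⟨hiT, hiB⟩ := Finset.mem_sdiff.1 hi
      intro x hx
      refine hlt i x ?_
      by_cases hxH : x ∈ H
      · have hxv : x = v := by
          by_contra hne
          refine hiB (Finset.mem_filter.2 ⟨Finset.mem_univ _, fun y hy => ?_⟩)
          rw [(Sym2.mem_and_mem_iff hne).1 ⟨hx, hTD i v hiT⟩, Sym2.mem_iff] at hy
          rcases hy with rfl | rfl <;> assumption
        rw [hxv, hd]
        exact (Finset.mem_filter.1 hiT).2
      · exact hlight i x hx hxH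
    · exact fun x hx => hlt i x (hlight i x hx ((Finset.mem_filter.1 hiS).2 x hx))
  have : (2 * c + 1) * H.card ≤ μ * H.card := Nat.mul_le_mul_right _ hμ
  nlinarith

theorem statement_3 {V : Type*} [Fintype V] (G : SimpleGraph V)
    (c μ M : ℕ) (l : List (Sym2 V)) (hstream : IsEdgeStream G l)
    (harb : ArboricityLE G c) (hμ : 2 * c < μ)
    (hM : MaxMatchingSize G M) :
    (1 / 2 - (c : ℝ) / (μ + 1)) * M ≤
      (EalphaCard l (max ((μ : ℝ) - 1) (4 * c * (μ + 1) / (μ + 1 - 2 * c))) : ℝ) := by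
  refine le_trans ?_ (Nat.cast_le.2 (hM.le_EalphaCard hstream harb hμ (le_max_left _ _)))
  refine mul_le_of_le_one_left (Nat.cast_nonneg M) ?_
  have : (0 : ℝ) ≤ c / (μ + 1) := by positivity
  linarith
end

section
/- Let S = (e_1, …, e_m) be any ordering (stream) of the edges of a finite simple graph G, let M* be the size of a maximum matching of G, let α ≥ 1, and let E_α be the set of α-good edges of S. Then |E_α| ≤ ((5/4)α + 2)·M*. -/
open SimpleGraph

variable {V : Type*}

/-- A finite set of (possibly degenerate) edges that pairwise share no vertex. -/
def PairwiseVertexDisjoint {V : Type*} (m : Finset (Sym2 V)) : Prop :=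
  ∀ e ∈ m, ∀ f ∈ m, ∀ x, x ∈ e → x ∈ f → e = f

/-- The vertex `x` lies on some edge of `m`. -/
def CoversVertex {V : Type*} (m : Finset (Sym2 V)) (x : V) : Prop :=
  ∃ e ∈ m, x ∈ e

/-- `m` is a matching of size `n` contained in the edge set `E`. -/
structure IsMatchingOfCard {V : Type*} (E : Finset (Sym2 V)) (n : ℕ)
    (m : Finset (Sym2 V)) : Prop where
  subset : m ⊆ E
  disjoint : PairwiseVertexDisjoint m
  card_eq : m.card = n

section EdgeCount

open Classical Finset

/-- Double counting of incidences for a set of proper edges inside `C`. -/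
lemma sum_card_incident_eq_two_mul (E : Finset (Sym2 V)) (C : Finset V)
    (hE : ∀ e ∈ E, ¬ e.IsDiag) (hC : ∀ e ∈ E, ∀ x ∈ e, x ∈ C) :
    ∑ x ∈ C, (E.filter (fun e => x ∈ e)).card = 2 * E.card := by
  have h := Finset.sum_card_bipartiteAbove_eq_sum_card_bipartiteBelow
    (s := C) (t := E) (fun x e => x ∈ e)
  simp only [Finset.bipartiteAbove, Finset.bipartiteBelow] at h
  rw [h, Finset.sum_congr rfl (g := fun _ => 2)]
  · simp [mul_comm]
  · intro e he
    rw [← Sym2.card_toFinset_of_not_isDiag e (hE e he)]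
    congr 1
    ext x
    simp only [Finset.mem_filter, Sym2.mem_toFinset]
    exact ⟨fun h => h.2, fun h => ⟨hC e he x h, h⟩⟩

lemma card_edges_le_choose (E : Finset (Sym2 V)) (C : Finset V)
    (hE : ∀ e ∈ E, ¬ e.IsDiag) (hC : ∀ e ∈ E, ∀ x ∈ e, x ∈ C) :
    E.card ≤ C.card.choose 2 := by
  rw [← Sym2.card_image_offDiag]
  apply Finset.card_le_card
  intro e he
  induction e using Sym2.ind with
  | _ x y =>
    have h1 := hC _ he x (by simp)
    have h2 := hC _ he y (by simp)
    have h3 := hE _ he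
    simp only [Sym2.mk_isDiag_iff] at h3
    exact Finset.mem_image.2 ⟨(x, y), by simp [h1, h2, h3], rfl⟩

/-- A simple graph with maximum degree at most `D` on `C` has at most `(D + 1) ⌊|C| / 2⌋` edges. -/
lemma card_edges_le_of_degree_le (E : Finset (Sym2 V)) (C : Finset V) (D : ℕ)
    (hE : ∀ e ∈ E, ¬ e.IsDiag) (hC : ∀ e ∈ E, ∀ x ∈ e, x ∈ C)
    (hD : ∀ x, (E.filter (fun e => x ∈ e)).card ≤ D) :
    E.card ≤ (D + 1) * (C.card / 2) := by
  have h1 : 2 * E.card ≤ C.card * D := by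
    rw [← sum_card_incident_eq_two_mul E C hE hC]
    exact Finset.sum_le_card_nsmul _ _ _ (fun x _ => hD x)
  have h2 := card_edges_le_choose E C hE hC
  obtain ⟨s, hs | hs⟩ := Nat.even_or_odd' C.card
  · rw [hs] at h1 ⊢
    rw [Nat.mul_div_cancel_left _ two_pos]
    nlinarith
  · rw [hs] at h1 h2 ⊢
    have hdiv : (2 * s + 1) / 2 = s := by omega
    have hch : (2 * s + 1).choose 2 = (2 * s + 1) * s := by
      rw [Nat.choose_two_right, Nat.add_sub_cancel, mul_left_comm,
        Nat.mul_div_cancel_left _ two_pos]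
    rw [hdiv]
    rw [hch] at h2
    rcases le_or_gt (2 * s) D with h | h
    · nlinarith
    · nlinarith

variable [Fintype V]

lemma card_filter_coversVertex (m : Finset (Sym2 V)) (hdiag : ∀ e ∈ m, ¬ e.IsDiag)
    (hm : PairwiseVertexDisjoint m) :
    (univ.filter (fun x => CoversVertex m x)).card = 2 * m.card := by
  rw [← sum_card_incident_eq_two_mul m univ hdiag (by simp), Finset.card_filter]
  refine Finset.sum_congr rfl fun x _ => ?_
  split_ifs with h
  · obtain ⟨e, he, hx⟩ := h
    symm
    rw [Finset.card_eq_one]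
    refine ⟨e, ?_⟩
    ext f
    simp only [Finset.mem_filter, Finset.mem_singleton]
    constructor
    · rintro ⟨hf, hxf⟩
      exact hm f hf e he x hxf hx
    · rintro rfl
      exact ⟨he, hx⟩
  · symm
    rw [Finset.card_eq_zero, Finset.filter_eq_empty_iff]
    exact fun e he hx => h ⟨e, he, hx⟩

/-- Gallai's exchange argument: if every vertex is missed by some maximum matching, then
the relation that no maximum matching misses both vertices is transitive. -/
lemma covers_or_covers_trans {E : Finset (Sym2 V)} {n : ℕ} (hE : ∀ e ∈ E, ¬ e.IsDiag)
    (hmax : ∀ m ⊆ E, PairwiseVertexDisjoint m → m.card ≤ n)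
    (hmiss : ∀ v, ∃ m, IsMatchingOfCard E n m ∧ ¬ CoversVertex m v) {u v w : V} (huw : u ≠ w)
    (huv : ∀ m, IsMatchingOfCard E n m → CoversVertex m u ∨ CoversVertex m v)
    (hvw : ∀ m, IsMatchingOfCard E n m → CoversVertex m v ∨ CoversVertex m w)
    (A : Finset (Sym2 V)) (hA : IsMatchingOfCard E n A) :
    CoversVertex A u ∨ CoversVertex A w := by
  by_contra hcon
  push Not at hcon
  obtain ⟨hAu, hAw⟩ := hcon
  obtain ⟨B₀, hB₀, hB₀v⟩ := hmiss v
  obtain ⟨B, hBmem, hBmax⟩ := Finset.exists_max_image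
    (E.powerset.filter (fun m => IsMatchingOfCard E n m ∧ ¬ CoversVertex m v))
    (fun m => (m ∩ A).card)
    ⟨B₀, by simp [hB₀, hB₀v, hB₀.subset]⟩
  simp only [Finset.mem_filter, Finset.mem_powerset] at hBmem hBmax
  obtain ⟨-, hB, hBv⟩ := hBmem
  have hBu := (huv B hB).resolve_right hBv
  have hBw := (hvw B hB).resolve_left hBv
  obtain ⟨x, hxv, ⟨e, heA, hxe⟩, hxB⟩ : ∃ x, x ≠ v ∧ CoversVertex A x ∧ ¬ CoversVertex B x := by
    by_contra! hno
    have hA2 := card_filter_coversVertex A (fun e he => hE e (hA.subset he)) hA.disjoint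
    have hB2 := card_filter_coversVertex B (fun e he => hE e (hB.subset he)) hB.disjoint
    rw [hA.card_eq] at hA2
    rw [hB.card_eq] at hB2
    have hsub : insert u (insert w ((univ.filter (fun x => CoversVertex A x)).erase v)) ⊆
        univ.filter (fun x => CoversVertex B x) := by
      intro x hx
      simp only [Finset.mem_insert, Finset.mem_erase, Finset.mem_filter, Finset.mem_univ,
        true_and] at hx ⊢
      rcases hx with rfl | rfl | ⟨h1, h2⟩
      · exact hBu
      · exact hBw
      · exact hno x h1 h2
    have hcard := Finset.card_le_card hsub
    rw [Finset.card_insert_of_notMem (by simp [huw, hAu]),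
      Finset.card_insert_of_notMem (by simp [hAw])] at hcard
    have := Finset.pred_card_le_card_erase (a := v)
      (s := univ.filter (fun x => CoversVertex A x))
    omega
  obtain ⟨y, rfl⟩ := Sym2.mem_iff_exists.1 hxe
  have heB : s(x, y) ∉ B := fun h => hxB ⟨_, h, hxe⟩
  have hyB : CoversVertex B y := by
    by_contra hyB
    have h := hmax (insert s(x, y) B)
      (Finset.insert_subset (hA.subset heA) hB.subset) ?_
    · rw [Finset.card_insert_of_notMem heB, hB.card_eq] at h
      omega
    · have hdisj : ∀ g ∈ B, ∀ z, z ∈ s(x, y) → z ∉ g := by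
        intro g hg z hz hzg
        rcases Sym2.mem_iff.1 hz with rfl | rfl
        · exact hxB ⟨g, hg, hzg⟩
        · exact hyB ⟨g, hg, hzg⟩
      intro g hg k hk z hzg hzk
      rw [Finset.mem_insert] at hg hk
      rcases hg with rfl | hg <;> rcases hk with rfl | hk
      · rfl
      · exact absurd hzk (hdisj k hk z hzg)
      · exact absurd hzg (hdisj g hg z hzk)
      · exact hB.disjoint g hg k hk z hzg hzk
  obtain ⟨f, hfB, hyf⟩ := hyB
  have hfe : f ≠ s(x, y) := fun h => heB (h ▸ hfB)
  have hfA : f ∉ A := fun h => hfe (hA.disjoint f h _ heA y hyf (by simp))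
  have hyv : y ≠ v := by
    rintro rfl
    exact hBv ⟨f, hfB, hyf⟩
  have hdisj : ∀ g ∈ B.erase f, ∀ z, z ∈ s(x, y) → z ∉ g := by
    intro g hg z hz hzg
    rw [Finset.mem_erase] at hg
    rcases Sym2.mem_iff.1 hz with rfl | rfl
    · exact hxB ⟨g, hg.2, hzg⟩
    · exact hg.1 (hB.disjoint g hg.2 f hfB _ hzg hyf)
  have heB' : s(x, y) ∉ B.erase f := fun h => heB (Finset.mem_of_mem_erase h)
  have hN : IsMatchingOfCard E n (insert s(x, y) (B.erase f)) := by
    refine ⟨Finset.insert_subset (hA.subset heA)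
      ((Finset.erase_subset _ _).trans hB.subset), ?_, ?_⟩
    · intro g hg k hk z hzg hzk
      rw [Finset.mem_insert] at hg hk
      rcases hg with rfl | hg <;> rcases hk with rfl | hk
      · rfl
      · exact absurd hzk (hdisj k hk z hzg)
      · exact absurd hzg (hdisj g hg z hzk)
      · exact hB.disjoint g (Finset.mem_of_mem_erase hg) k (Finset.mem_of_mem_erase hk) z hzg hzk
    · rw [Finset.card_insert_of_notMem heB', Finset.card_erase_add_one hfB, hB.card_eq]
  have hNv : ¬ CoversVertex (insert s(x, y) (B.erase f)) v := by
    rintro ⟨g, hg, hvg⟩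
    rcases Finset.mem_insert.1 hg with rfl | hg
    · rcases Sym2.mem_iff.1 hvg with h | h
      · exact hxv h.symm
      · exact hyv h.symm
    · exact hBv ⟨g, Finset.mem_of_mem_erase hg, hvg⟩
  have hle := hBmax _ ⟨hN.subset, hN, hNv⟩
  have hins : insert s(x, y) (B ∩ A) ⊆ insert s(x, y) (B.erase f) ∩ A := by
    intro g hg
    rcases Finset.mem_insert.1 hg with rfl | hg
    · simp [heA]
    · rw [Finset.mem_inter] at hg
      have hgf : g ≠ f := fun h => hfA (h ▸ hg.2)
      simp [hg.1, hg.2, hgf]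
  have hcard := Finset.card_le_card hins
  rw [Finset.card_insert_of_notMem (by simp [heB])] at hcard
  omega

/-- If every vertex is missed by some maximum matching, the number of edges is bounded by
`D + 1` times the matching number, by summing over Gallai's equivalence classes. -/
lemma card_edges_le_of_forall_missed {E : Finset (Sym2 V)} {n D : ℕ}
    (hE : ∀ e ∈ E, ¬ e.IsDiag)
    (hD : ∀ x, (E.filter (fun e => x ∈ e)).card ≤ D)
    (hmax : ∀ m ⊆ E, PairwiseVertexDisjoint m → m.card ≤ n)
    (hmiss : ∀ v, ∃ m, IsMatchingOfCard E n m ∧ ¬ CoversVertex m v)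
    {A : Finset (Sym2 V)} (hA : IsMatchingOfCard E n A) :
    E.card ≤ (D + 1) * n := by
  let s : Setoid V :=
    { r := fun u v => u = v ∨
        ∀ m, IsMatchingOfCard E n m → CoversVertex m u ∨ CoversVertex m v
      iseqv :=
        { refl := fun u => Or.inl rfl
          symm := by
            rintro u v (h | h)
            · exact Or.inl h.symm
            · exact Or.inr fun m hm => (h m hm).symm
          trans := by
            rintro u v w (rfl | huv) (rfl | hvw)
            · exact Or.inl rfl
            · exact Or.inr hvw
            · exact Or.inr huv
            · by_cases huw : u = w
              · exact Or.inl huw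
              · exact Or.inr (covers_or_covers_trans hE hmax hmiss huw huv hvw) } }
  have hadj : ∀ x y, s(x, y) ∈ E → s.r x y := by
    intro x y hxy
    refine Or.inr fun m hm => ?_
    by_contra! hno
    have hnot : s(x, y) ∉ m := fun h => hno.1 ⟨_, h, by simp⟩
    have h := hmax (insert s(x, y) m) (Finset.insert_subset hxy hm.subset) ?_
    · rw [Finset.card_insert_of_notMem hnot, hm.card_eq] at h
      omega
    · have hdisj : ∀ g ∈ m, ∀ z, z ∈ s(x, y) → z ∉ g := by
        intro g hg z hz hzg
        rcases Sym2.mem_iff.1 hz with rfl | rfl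
        · exact hno.1 ⟨g, hg, hzg⟩
        · exact hno.2 ⟨g, hg, hzg⟩
      intro g hg k hk z hzg hzk
      rw [Finset.mem_insert] at hg hk
      rcases hg with rfl | hg <;> rcases hk with rfl | hk
      · rfl
      · exact absurd hzk (hdisj k hk z hzg)
      · exact absurd hzg (hdisj g hg z hzk)
      · exact hm.disjoint g hg k hk z hzg hzk
  let cls : Sym2 V → Quotient s := fun e => Quotient.mk s (Quot.out e).1
  have hcls : ∀ e ∈ E, ∀ x ∈ e, Quotient.mk s x = cls e := by
    intro e he x hx
    obtain ⟨y, hy⟩ := Sym2.mem_iff_exists.1 (Sym2.out_fst_mem e)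
    apply Quotient.sound
    have hx' := hx
    rw [hy] at hx'
    rcases Sym2.mem_iff.1 hx' with h | h
    · exact Or.inl h
    · apply s.symm
      rw [h]
      apply hadj
      rw [← hy]
      exact he
  rw [← hA.card_eq, Finset.card_eq_sum_card_fiberwise (f := cls) (t := univ) (s := E) (by simp),
    Finset.card_eq_sum_card_fiberwise (f := cls) (t := univ) (s := A) (by simp),
    Finset.mul_sum]
  refine Finset.sum_le_sum fun q _ => ?_
  set C : Finset V := univ.filter (fun x => Quotient.mk s x = q) with hCdef
  refine (card_edges_le_of_degree_le _ C D (fun e he => hE e (Finset.mem_filter.1 he).1) ?_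
    (fun x => le_trans (Finset.card_le_card ?_) (hD x))).trans (Nat.mul_le_mul_left _ ?_)
  · intro e he x hx
    rw [Finset.mem_filter] at he
    simp [hCdef, hcls e he.1 x hx, he.2]
  · exact Finset.filter_subset_filter _ (Finset.filter_subset _ _)
  · have hdisj : PairwiseVertexDisjoint (A.filter (fun e => cls e = q)) :=
      fun e he f hf => hA.disjoint e (Finset.mem_filter.1 he).1 f (Finset.mem_filter.1 hf).1
    have hcov := card_filter_coversVertex (A.filter (fun e => cls e = q))
      (fun e he => hE e (hA.subset (Finset.mem_filter.1 he).1)) hdisj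
    have hone : (C \ univ.filter
        (fun x => CoversVertex (A.filter (fun e => cls e = q)) x)).card ≤ 1 := by
      rw [Finset.card_le_one]
      intro a ha b hb
      simp only [hCdef, Finset.mem_sdiff, Finset.mem_filter, Finset.mem_univ, true_and] at ha hb
      have key : ∀ z, Quotient.mk s z = q → CoversVertex A z →
          CoversVertex (A.filter (fun e => cls e = q)) z := by
        rintro z hz ⟨e, he, hze⟩
        refine ⟨e, Finset.mem_filter.2 ⟨he, ?_⟩, hze⟩
        rw [← hcls e (hA.subset he) z hze, hz]
      rcases Quotient.exact (ha.1.trans hb.1.symm) with h | h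
      · exact h
      · rcases h A hA with h | h
        · exact absurd (key a ha.1 h) ha.2
        · exact absurd (key b hb.1 h) hb.2
    have := Finset.card_le_card_sdiff_add_card (s := C)
      (t := univ.filter (fun x => CoversVertex (A.filter (fun e => cls e = q)) x))
    omega

/-- A finite simple graph with maximum degree at most `D` and matching number at most `n` has
at most `(D + 1) n` edges. -/
theorem card_edges_le_mul_matching (D n : ℕ) (E : Finset (Sym2 V))
    (hE : ∀ e ∈ E, ¬ e.IsDiag)
    (hD : ∀ x, (E.filter (fun e => x ∈ e)).card ≤ D)
    (hmax : ∀ m ⊆ E, PairwiseVertexDisjoint m → m.card ≤ n) :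
    E.card ≤ (D + 1) * n := by
  induction n generalizing E with
  | zero =>
    have : E = ∅ := by
      by_contra hne
      obtain ⟨e, he⟩ := Finset.nonempty_iff_ne_empty.2 hne
      have := hmax {e} (by simpa using he) (by
        intro a ha b hb x _ _
        rw [Finset.mem_singleton] at ha hb
        rw [ha, hb])
      simp at this
    simp [this]
  | succ n ih =>
    by_cases hex : ∃ A, IsMatchingOfCard E (n + 1) A
    · obtain ⟨A, hA⟩ := hex
      by_cases hmiss : ∀ v, ∃ m, IsMatchingOfCard E (n + 1) m ∧ ¬ CoversVertex m v
      · exact card_edges_le_of_forall_missed hE hD hmax hmiss hA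
      · push Not at hmiss
        obtain ⟨v, hv⟩ := hmiss
        have h := ih (E.filter (fun e => v ∉ e)) (fun e he => hE e (Finset.mem_filter.1 he).1)
          (fun x => (Finset.card_le_card
            (Finset.filter_subset_filter _ (Finset.filter_subset _ _))).trans (hD x)) ?_
        · have h1 := Finset.card_filter_add_card_filter_not (s := E) (fun e => v ∈ e)
          have h2 := hD v
          nlinarith
        · intro m hm hdisj
          have hmE := hm.trans (Finset.filter_subset _ _)
          have hle := hmax m hmE hdisj
          by_contra hlt
          obtain ⟨e, he, hve⟩ := hv m ⟨hmE, hdisj, by omega⟩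
          exact (Finset.mem_filter.1 (hm he)).2 hve
    · refine (ih E hE hD fun m hm hdisj => ?_).trans (Nat.mul_le_mul_left _ n.le_succ)
      have hle := hmax m hm hdisj
      by_contra hlt
      exact hex ⟨m, hm, hdisj, by omega⟩

end EdgeCount

/-- A pairwise vertex-disjoint set of edges of `G` is at most as large as a maximum matching. -/
lemma MaxMatchingSize.card_le {V : Type*} {G : SimpleGraph V} {M : ℕ} (hM : MaxMatchingSize G M)
    (m : Finset (Sym2 V)) (hm : ∀ e ∈ m, e ∈ G.edgeSet) (hdisj : PairwiseVertexDisjoint m) :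
    m.card ≤ M := by
  let H : G.Subgraph :=
    { verts := {x | CoversVertex m x}
      Adj := fun x y => s(x, y) ∈ m
      adj_sub := fun h => hm _ h
      edge_vert := fun h => ⟨_, h, by simp⟩
      symm := ⟨fun x y h => by rwa [Sym2.eq_swap]⟩ }
  have hH : H.IsMatching := by
    rintro x ⟨e, he, hx⟩
    obtain ⟨y, rfl⟩ := Sym2.mem_iff_exists.1 hx
    refine ⟨y, he, fun z hz => ?_⟩
    have := hdisj _ hz _ he x (by simp) hx
    exact Sym2.congr_right.1 this
  have hedge : H.edgeSet = (m : Set (Sym2 V)) := by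
    ext e
    induction e using Sym2.ind with
    | _ x y => rfl
  have h := hM.2 H hH
  rwa [hedge, Set.ncard_coe_finset] at h

theorem statement_4 {V : Type*} [Fintype V] (G : SimpleGraph V)
    (M : ℕ) (α : ℝ) (hα : 1 ≤ α)
    (l : List (Sym2 V)) (hstream : IsEdgeStream G l)
    (hM : MaxMatchingSize G M) :
    (EalphaCard l α : ℝ) ≤ (5 / 4 * α + 2) * M := by
  classical
  obtain ⟨hnodup, hmem⟩ := hstream
  have hinj : Function.Injective l.get := List.nodup_iff_injective_get.1 hnodup
  let I : Finset (Fin l.length) := Finset.univ.filter (fun i => AlphaGood l α i)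
  have hI : EalphaCard l α = I.card := by
    rw [EalphaCard, ← Set.ncard_coe_finset]
    simp [I]
  have hsub : ∀ e ∈ I.image l.get, e ∈ G.edgeSet := by
    intro e he
    obtain ⟨i, -, rfl⟩ := Finset.mem_image.1 he
    exact (hmem _).1 (List.get_mem l i)
  have hdeg : ∀ x, ((I.image l.get).filter (fun e => x ∈ e)).card ≤ ⌊α⌋₊ + 1 := by
    intro x
    rw [Finset.filter_image, Finset.card_image_of_injective _ hinj]
    set J := I.filter (fun i => x ∈ l.get i) with hJ
    rcases J.eq_empty_or_nonempty with h | h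
    · simp [h]
    · obtain ⟨hgood, hx⟩ := Finset.mem_filter.1 (J.min'_mem h)
      have hd : (dAfter l (J.min' h : ℕ) x : ℝ) ≤ α := (Finset.mem_filter.1 hgood).2 x hx
      have hle : (J.erase (J.min' h)).card ≤ dAfter l (J.min' h : ℕ) x := by
        rw [dAfter, ← Set.ncard_coe_finset]
        refine Set.ncard_le_ncard (fun j hj => ?_) (Set.toFinite _)
        have hj' : j ∈ J.erase (J.min' h) := hj
        exact ⟨J.min'_lt_of_mem_erase_min' h hj',
          (Finset.mem_filter.1 (Finset.mem_of_mem_erase hj')).2⟩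
      have := Nat.le_floor hd
      have := Finset.pred_card_le_card_erase (a := J.min' h) (s := J)
      omega
  have hmain := card_edges_le_mul_matching (⌊α⌋₊ + 1) M (I.image l.get)
    (fun e he => G.not_isDiag_of_mem_edgeSet (hsub e he))
    (fun x => by convert hdeg x)
    (fun m hm hdisj => hM.card_le m (fun e he => hsub e (hm he)) hdisj)
  rw [Finset.card_image_of_injective _ hinj, ← hI] at hmain
  have hfloor : (⌊α⌋₊ : ℝ) ≤ α := Nat.floor_le (by linarith)
  calc (EalphaCard l α : ℝ) ≤ ((⌊α⌋₊ + 1 + 1) * M : ℝ) := by exact_mod_cast hmain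
    _ ≤ (5 / 4 * α + 2) * M := by
      apply mul_le_mul_of_nonneg_right _ (Nat.cast_nonneg M)
      linarith
end

section
/- Let S be any ordering (stream) of the edges of a finite simple graph G with arboricity at most c (c ≥ 1), let M* be the size of a maximum matching of G, and let E_{6c} be the set of 6c-good edges of S. Then M* ≤ 3·|E_{6c}| ≤ (22.5c + 6)·M*. -/
open SimpleGraph

variable {V : Type*}

open Classical in
/-- A finite set has at most `k + 1` elements with at most `k` larger elements. -/
lemma card_filter_card_gt_le {α : Type*} [LinearOrder α] (A : Finset α) (k : ℕ) :
    {i ∈ A | {j ∈ A | i < j}.card ≤ k}.card ≤ k + 1 := by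
  rcases {i ∈ A | {j ∈ A | i < j}.card ≤ k}.eq_empty_or_nonempty with h | h
  · simp [h]
  · obtain ⟨m, hm, hmin⟩ := Finset.exists_min_image _ id h
    have hsub : {i ∈ A | {j ∈ A | i < j}.card ≤ k} ⊆ insert m {j ∈ A | m < j} := by
      intro i hi
      rcases (hmin i hi).eq_or_lt with he | hl
      · exact Finset.mem_insert.2 (Or.inl he.symm)
      · exact Finset.mem_insert_of_mem
          (Finset.mem_filter.2 ⟨(Finset.mem_filter.1 hi).1, hl⟩)
    have h1 := Finset.card_le_card hsub
    have h2 := Finset.card_insert_le m {j ∈ A | m < j}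
    have h3 := (Finset.mem_filter.1 hm).2
    omega

open Classical in
/-- A finite set with more than `k` elements has at least `k + 1` elements with at most `k` larger
elements. -/
lemma le_card_filter_card_gt {α : Type*} [LinearOrder α] (A : Finset α) (k : ℕ)
    (hA : k < A.card) : k + 1 ≤ {i ∈ A | {j ∈ A | i < j}.card ≤ k}.card := by
  rcases {i ∈ A | k < {j ∈ A | i < j}.card}.eq_empty_or_nonempty with h | h
  · rw [Finset.filter_true_of_mem]
    · exact hA
    · intro i hi
      have := Finset.filter_eq_empty_iff.1 h hi
      omega
  · obtain ⟨m, hm, hmax⟩ := Finset.exists_max_image _ id h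
    refine le_trans (Finset.mem_filter.1 hm).2 (Finset.card_le_card ?_)
    intro i hi
    obtain ⟨hiA, hmi⟩ := Finset.mem_filter.1 hi
    refine Finset.mem_filter.2 ⟨hiA, ?_⟩
    by_contra hc
    have := hmax i (Finset.mem_filter.2 ⟨hiA, not_le.1 hc⟩)
    exact absurd hmi (not_lt.2 this)

/-- An acyclic graph has at most as many edges as vertices. -/
lemma SimpleGraph.IsAcyclic.card_edgeSet_le [Finite V] {F : SimpleGraph V} (hF : F.IsAcyclic) :
    Nat.card F.edgeSet ≤ Nat.card V := by
  classical
  have := Fintype.ofFinite V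
  rcases isEmpty_or_nonempty V with h | h
  · have : IsEmpty F.edgeSet := ⟨fun e => e.1.ind (fun x _ => h.false x)⟩
    simp
  · obtain ⟨T, hFT, -, hT⟩ :=
      (connected_top (V := V)).exists_isTree_le_of_le_of_isAcyclic le_top hF
    have h1 := (isTree_iff_connected_and_card.1 hT).2
    have h2 := Nat.card_mono (Set.toFinite _) (edgeSet_mono hFT)
    omega

/-- An acyclic graph has at most `#W` edges inside a vertex set `W`. -/
lemma SimpleGraph.IsAcyclic.ncard_edgeSet_inside_le {F : SimpleGraph V}
    (hF : F.IsAcyclic) (W : Finset V) :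
    {e ∈ F.edgeSet | ∀ x ∈ e, x ∈ W}.ncard ≤ W.card := by
  have h := (hF.induce (W : Set V)).card_edgeSet_le
  have hsub : {e ∈ F.edgeSet | ∀ x ∈ e, x ∈ W} ⊆
      Sym2.map Subtype.val '' (F.induce (W : Set V)).edgeSet := by
    intro e
    induction e with
    | h x y =>
      rintro ⟨he, hW⟩
      exact ⟨s(⟨x, hW x (by simp)⟩, ⟨y, hW y (by simp)⟩), by simpa using he, by simp⟩
  have h1 := Set.ncard_le_ncard hsub (Set.toFinite _)
  have h2 := Set.ncard_image_le (f := Sym2.map Subtype.val)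
    (Set.toFinite (F.induce (W : Set V)).edgeSet)
  simp only [Nat.card_coe_set_eq, Set.ncard_coe_finset] at h
  omega

/-- A graph of arboricity at most `c` has at most `c * #W` edges inside a vertex set `W`. -/
lemma ArboricityLE.ncard_edgeSet_inside_le [Finite V] {G : SimpleGraph V} {c : ℕ}
    (h : ArboricityLE G c) (W : Finset V) :
    {e ∈ G.edgeSet | ∀ x ∈ e, x ∈ W}.ncard ≤ c * W.card := by
  obtain ⟨F, hF, -, hcov⟩ := h
  have hsub : {e ∈ G.edgeSet | ∀ x ∈ e, x ∈ W} ⊆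
      ⋃ i, {e ∈ (F i).edgeSet | ∀ x ∈ e, x ∈ W} := by
    intro e
    induction e with
    | h x y =>
      rintro ⟨he, hW⟩
      obtain ⟨i, hi⟩ := hcov he
      exact Set.mem_iUnion.2 ⟨i, hi, hW⟩
  calc _ ≤ (⋃ i, {e ∈ (F i).edgeSet | ∀ x ∈ e, x ∈ W}).ncard :=
        Set.ncard_le_ncard hsub (Set.toFinite _)
    _ ≤ ∑ i, {e ∈ (F i).edgeSet | ∀ x ∈ e, x ∈ W}.ncard := Set.ncard_iUnion_le_of_fintype _
    _ ≤ ∑ _i : Fin c, W.card := Finset.sum_le_sum fun i _ => (hF i).ncard_edgeSet_inside_le W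
    _ = c * W.card := by simp

/-- A matching given as a finite set of pairwise disjoint edges. -/
def IsEdgeMatching (G : SimpleGraph V) (T : Finset (Sym2 V)) : Prop :=
  (∀ a ∈ T, a ∈ G.edgeSet) ∧ ∀ a ∈ T, ∀ b ∈ T, ∀ x, x ∈ a → x ∈ b → a = b

lemma MaxMatchingSize.card_le_s5 {G : SimpleGraph V} {M : ℕ} (hM : MaxMatchingSize G M)
    {T : Finset (Sym2 V)} (hT : IsEdgeMatching G T) : T.card ≤ M := by
  let H : G.Subgraph :=
    { verts := {x | ∃ e ∈ T, x ∈ e}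
      Adj := fun x y => s(x, y) ∈ T
      adj_sub := fun h => hT.1 _ h
      edge_vert := fun h => ⟨_, h, by simp⟩
      symm := ⟨fun x y h => by rwa [Sym2.eq_swap]⟩ }
  have hH : H.IsMatching := by
    rintro x ⟨e, he, hx⟩
    obtain ⟨y, rfl⟩ := Sym2.mem_iff_exists.1 hx
    refine ⟨y, he, fun z hz => ?_⟩
    have := hT.2 _ hz _ he x (by simp) (by simp)
    exact Sym2.congr_right.1 this
  have hE : H.edgeSet = T := by
    ext e
    induction e with
    | h x y => rfl
  have := hM.2 H hH
  rwa [hE, Set.ncard_coe_finset] at this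

lemma MaxMatchingSize.exists_card_eq [Finite V] {G : SimpleGraph V} {M : ℕ}
    (hM : MaxMatchingSize G M) : ∃ T : Finset (Sym2 V), IsEdgeMatching G T ∧ T.card = M := by
  obtain ⟨⟨H, hH, hcard⟩, -⟩ := hM
  refine ⟨(Set.toFinite H.edgeSet).toFinset, ⟨?_, ?_⟩, ?_⟩
  · intro a ha
    exact H.edgeSet_subset (by simpa using ha)
  · intro a ha b hb x hxa hxb
    obtain ⟨y, rfl⟩ := Sym2.mem_iff_exists.1 hxa
    obtain ⟨z, rfl⟩ := Sym2.mem_iff_exists.1 hxb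
    simp only [Set.Finite.mem_toFinset, Subgraph.mem_edgeSet] at ha hb
    rw [hH.eq_of_adj_left ha hb]
  · rw [← hcard, Set.ncard_eq_toFinset_card]

/-- The neighbours of `w` that are not covered by the edge set `T` are all equal. -/
def AtMostOneExposedNeighbor (G : SimpleGraph V) (T : Finset (Sym2 V)) (w : V) : Prop :=
  ∀ x y, (∀ a ∈ T, x ∉ a) → (∀ a ∈ T, y ∉ a) → G.Adj w x → G.Adj w y → x = y

lemma IsEdgeMatching.insert [DecidableEq V] {G : SimpleGraph V} {T : Finset (Sym2 V)}
    (hT : IsEdgeMatching G T) {x y : V} (hxy : G.Adj x y) (hx : ∀ a ∈ T, x ∉ a)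
    (hy : ∀ a ∈ T, y ∉ a) : IsEdgeMatching G (insert s(x, y) T) := by
  obtain ⟨h1, h2⟩ := hT
  refine ⟨fun a ha => ?_, fun a ha b hb z hza hzb => ?_⟩
  · rcases Finset.mem_insert.1 ha with rfl | ha
    exacts [hxy, h1 a ha]
  · rcases Finset.mem_insert.1 ha with rfl | ha <;> rcases Finset.mem_insert.1 hb with rfl | hb
    · rfl
    · rcases Sym2.mem_iff.1 hza with rfl | rfl
      exacts [absurd hzb (hx b ‹_›), absurd hzb (hy b ‹_›)]
    · rcases Sym2.mem_iff.1 hzb with rfl | rfl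
      exacts [absurd hza (hx a ‹_›), absurd hza (hy a ‹_›)]
    · exact h2 a ha b hb z hza hzb

lemma IsEdgeMatching.erase [DecidableEq V] {G : SimpleGraph V} {T : Finset (Sym2 V)}
    (hT : IsEdgeMatching G T) (a : Sym2 V) : IsEdgeMatching G (T.erase a) :=
  ⟨fun b hb => hT.1 b (Finset.mem_of_mem_erase hb), fun b hb d hd =>
    hT.2 b (Finset.mem_of_mem_erase hb) d (Finset.mem_of_mem_erase hd)⟩

/-- The vertices exposed by a maximum matching are independent. -/
lemma IsEdgeMatching.not_adj_of_exposed {G : SimpleGraph V} {T : Finset (Sym2 V)}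
    (hT : IsEdgeMatching G T) (hmax : MaxMatchingSize G T.card) {x y : V}
    (hx : ∀ a ∈ T, x ∉ a) (hy : ∀ a ∈ T, y ∉ a) : ¬ G.Adj x y := by
  classical
  intro hxy
  have h := hmax.card_le_s5 (hT.insert hxy hx hy)
  rw [Finset.card_insert_of_notMem fun h => hx _ h (by simp)] at h
  omega

/-- Absence of augmenting paths of length three: in a maximum matching, the ends of a matching
edge have no two distinct exposed neighbours. -/
lemma IsEdgeMatching.eq_of_adj_exposed {G : SimpleGraph V} {T : Finset (Sym2 V)}
    (hT : IsEdgeMatching G T) (hmax : MaxMatchingSize G T.card) {p q x y : V}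
    (hpq : s(p, q) ∈ T) (hx : ∀ a ∈ T, x ∉ a) (hy : ∀ a ∈ T, y ∉ a)
    (hpx : G.Adj p x) (hqy : G.Adj q y) : x = y := by
  classical
  by_contra hne
  have hp : ∀ a ∈ T.erase s(p, q), p ∉ a := fun a ha hpa =>
    (Finset.mem_erase.1 ha).1 (hT.2 a (Finset.mem_of_mem_erase ha) _ hpq p hpa (by simp))
  have hq : ∀ a ∈ T.erase s(p, q), q ∉ a := fun a ha hqa =>
    (Finset.mem_erase.1 ha).1 (hT.2 a (Finset.mem_of_mem_erase ha) _ hpq q hqa (by simp))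
  have hx' : ∀ a ∈ T.erase s(p, q), x ∉ a := fun a ha => hx a (Finset.mem_of_mem_erase ha)
  have hy' : ∀ a ∈ T.erase s(p, q), y ∉ a := fun a ha => hy a (Finset.mem_of_mem_erase ha)
  have hpq' : p ≠ q := G.ne_of_adj (hT.1 _ hpq)
  have hxq : q ≠ x := fun h => hx _ hpq (by simp [← h])
  have hyp : y ≠ p := fun h => hy _ hpq (by simp [h])
  have h1 := (hT.erase s(p, q)).insert hpx hp hx'
  have h2 := h1.insert hqy
    (fun a ha => by
      rcases Finset.mem_insert.1 ha with rfl | ha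
      · simp [hpq'.symm, hxq]
      · exact hq a ha)
    (fun a ha => by
      rcases Finset.mem_insert.1 ha with rfl | ha
      · simp [hyp, Ne.symm hne]
      · exact hy' a ha)
  have h3 := hmax.card_le_s5 h2
  rw [Finset.card_insert_of_notMem, Finset.card_insert_of_notMem fun h => hp _ h (by simp)] at h3
  · have := Finset.card_erase_add_one hpq
    omega
  · intro h
    rcases Finset.mem_insert.1 h with h | h
    · have : q ∈ s(p, x) := h ▸ Sym2.mem_mk_left q y
      simp [hpq'.symm, hxq] at this
    · exact hq _ h (by simp)

/-- Every edge of a maximum matching has an end with at most one exposed neighbour. -/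
lemma IsEdgeMatching.exists_atMostOneExposedNeighbor {G : SimpleGraph V} {T : Finset (Sym2 V)}
    (hT : IsEdgeMatching G T) (hmax : MaxMatchingSize G T.card) {a : Sym2 V} (ha : a ∈ T) :
    ∃ u w, a = s(u, w) ∧ AtMostOneExposedNeighbor G T w := by
  induction a with
  | h p q =>
    by_cases hq : AtMostOneExposedNeighbor G T q
    · exact ⟨p, q, rfl, hq⟩
    · refine ⟨q, p, Sym2.eq_swap, fun z z' hz hz' hpz hpz' => ?_⟩
      simp only [AtMostOneExposedNeighbor, not_forall] at hq
      obtain ⟨x, y, hx, hy, hqx, hqy, hne⟩ := hq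
      exact absurd ((hT.eq_of_adj_exposed hmax ha hz hx hpz hqx).symm.trans
        (hT.eq_of_adj_exposed hmax ha hz hy hpz hqy)) hne

section Stream

variable {G : SimpleGraph V} {l : List (Sym2 V)}

lemma IsEdgeStream.get_injective (h : IsEdgeStream G l) : Function.Injective l.get :=
  List.nodup_iff_injective_get.1 h.1

lemma IsEdgeStream.get_mem_edgeSet (h : IsEdgeStream G l) (i : Fin l.length) :
    l.get i ∈ G.edgeSet :=
  (h.2 _).1 (List.get_mem l i)

lemma alphaGood_natCast_iff {k : ℕ} {i : Fin l.length} :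
    AlphaGood l (k : ℝ) i ↔ ∀ x ∈ l.get i, dAfter l i x ≤ k := by
  simp [AlphaGood]

open Classical in
/-- The positions of the edges of the stream that are incident to `x`. -/
noncomputable def incidentPositions (l : List (Sym2 V)) (x : V) : Finset (Fin l.length) :=
  {i | x ∈ l.get i}

lemma mem_incidentPositions {x : V} {i : Fin l.length} :
    i ∈ incidentPositions l x ↔ x ∈ l.get i := by
  simp [incidentPositions]

open Classical in
lemma dAfter_eq_card (i : Fin l.length) (x : V) :
    dAfter l i x = {j ∈ incidentPositions l x | i < j}.card := by
  rw [dAfter, ← Set.ncard_coe_finset]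
  congr 1
  ext j
  simp [mem_incidentPositions, and_comm]

lemma dAfter_le_card (i : Fin l.length) (x : V) :
    dAfter l i x ≤ (incidentPositions l x).card := by
  classical
  rw [dAfter_eq_card]
  exact Finset.card_filter_le _ _

open Classical in
/-- The positions of the last `k + 1` edges of the stream that are incident to `x`. -/
noncomputable def lastPositions (l : List (Sym2 V)) (k : ℕ) (x : V) : Finset (Fin l.length) :=
  {i ∈ incidentPositions l x | dAfter l i x ≤ k}

lemma mem_lastPositions {k : ℕ} {x : V} {i : Fin l.length} :
    i ∈ lastPositions l k x ↔ x ∈ l.get i ∧ dAfter l i x ≤ k := by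
  simp [lastPositions, mem_incidentPositions]

lemma card_lastPositions_le (k : ℕ) (x : V) : (lastPositions l k x).card ≤ k + 1 := by
  classical
  simp only [lastPositions, dAfter_eq_card]
  exact card_filter_card_gt_le _ _

lemma le_card_lastPositions {k : ℕ} {x : V} (h : k < (incidentPositions l x).card) :
    k + 1 ≤ (lastPositions l k x).card := by
  classical
  simp only [lastPositions, dAfter_eq_card]
  exact le_card_filter_card_gt _ _ h

open Classical in
/-- The positions of the edges both of whose ends are incident to at most `k` later edges. -/
noncomputable def goodPositions (l : List (Sym2 V)) (k : ℕ) : Finset (Fin l.length) :=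
  {i | ∀ x ∈ l.get i, dAfter l i x ≤ k}

lemma mem_goodPositions {k : ℕ} {i : Fin l.length} :
    i ∈ goodPositions l k ↔ ∀ x ∈ l.get i, dAfter l i x ≤ k := by
  simp [goodPositions]

open Classical in
/-- The positions of the edges both of whose ends lie in `W`. -/
noncomputable def positionsInside (l : List (Sym2 V)) (W : Finset V) : Finset (Fin l.length) :=
  {i | ∀ x ∈ l.get i, x ∈ W}

lemma mem_positionsInside {W : Finset V} {i : Fin l.length} :
    i ∈ positionsInside l W ↔ ∀ x ∈ l.get i, x ∈ W := by
  simp [positionsInside]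

lemma IsEdgeStream.card_positionsInside_le [Finite V] (h : IsEdgeStream G l) {c : ℕ}
    (harb : ArboricityLE G c) (W : Finset V) :
    (positionsInside l W).card ≤ c * W.card := by
  refine le_trans ?_ (harb.ncard_edgeSet_inside_le W)
  rw [← Set.ncard_coe_finset, ← Set.ncard_image_of_injective _ h.get_injective]
  refine Set.ncard_le_ncard ?_ (Set.toFinite _)
  rintro _ ⟨i, hi, rfl⟩
  exact ⟨h.get_mem_edgeSet i, mem_positionsInside.1 hi⟩

/-- If `2 * c ≤ k` and `G` has arboricity at most `c`, there are at least as many `k`-good edges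
as edges in a maximum matching. -/
lemma IsEdgeStream.maxMatchingSize_le_card_good [Finite V] (h : IsEdgeStream G l) {c k M : ℕ}
    (harb : ArboricityLE G c) (hM : MaxMatchingSize G M) (hk : 2 * c ≤ k) :
    M ≤ (goodPositions l k).card := by
  classical
  have := Fintype.ofFinite V
  obtain ⟨T, hT, rfl⟩ := hM.exists_card_eq
  set heavy : Finset V := {x | k < (incidentPositions l x).card}
  have mem_heavy : ∀ x, x ∈ heavy ↔ k < (incidentPositions l x).card := by simp [heavy]
  set light : Finset (Fin l.length) := {i | ∀ x ∈ l.get i, x ∉ heavy} with hlight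
  set mixed : Finset (Fin l.length) :=
    {i | (∀ x ∈ l.get i, dAfter l i x ≤ k) ∧ ∃ x ∈ l.get i, x ∈ heavy} with hmixed
  set inside : Finset (Fin l.length) := positionsInside l heavy with hinside
  have hin : inside.card ≤ c * heavy.card := h.card_positionsInside_le harb heavy
  have hdouble : (k + 1) * heavy.card ≤ mixed.card + 2 * inside.card := by
    calc (k + 1) * heavy.card = ∑ x ∈ heavy, (k + 1) := by simp [mul_comm]
      _ ≤ ∑ x ∈ heavy, (lastPositions l k x).card :=
          Finset.sum_le_sum fun x hx => le_card_lastPositions ((mem_heavy x).1 hx)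
      _ = ∑ i, {x ∈ heavy | i ∈ lastPositions l k x}.card := by
          simpa [Finset.bipartiteAbove, Finset.bipartiteBelow] using
            Finset.sum_card_bipartiteAbove_eq_sum_card_bipartiteBelow (s := heavy)
              (t := Finset.univ) (fun x i => i ∈ lastPositions l k x)
      _ ≤ ∑ i, ((if i ∈ mixed then 1 else 0) + 2 * (if i ∈ inside then 1 else 0)) := by
          refine Finset.sum_le_sum fun i _ => ?_
          obtain ⟨p, q, hpq⟩ : ∃ p q, l.get i = s(p, q) :=
            (l.get i).ind (fun p q => ⟨p, q, rfl⟩)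
          have hsub : {x ∈ heavy | i ∈ lastPositions l k x} ⊆ {p, q} := by
            intro x hx
            have := (mem_lastPositions.1 (Finset.mem_filter.1 hx).2).1
            rw [hpq] at this
            simpa using this
          by_cases hi : i ∈ inside
          · have := (Finset.card_le_card hsub).trans Finset.card_le_two
            simp only [hi, if_true]
            omega
          · simp only [hi, if_false]
            rcases {x ∈ heavy | i ∈ lastPositions l k x}.eq_empty_or_nonempty with he | ⟨x, hx⟩
            · simp [he]
            · obtain ⟨hxH, hxL⟩ := Finset.mem_filter.1 hx
              obtain ⟨hxe, hxd⟩ := mem_lastPositions.1 hxL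
              obtain ⟨y, hxy⟩ := Sym2.mem_iff_exists.1 hxe
              have hy : y ∉ heavy := fun hy => hi (by
                simp only [hinside, mem_positionsInside, hxy, Sym2.mem_iff]
                rintro z (rfl | rfl) <;> assumption)
              have hmix : i ∈ mixed := by
                simp only [hmixed, Finset.mem_filter, Finset.mem_univ, true_and]
                refine ⟨fun z hz => ?_, x, hxe, hxH⟩
                rw [hxy, Sym2.mem_iff] at hz
                rcases hz with rfl | rfl
                · exact hxd
                · have := (dAfter_le_card i z).trans (not_lt.1 (mt (mem_heavy z).2 hy))
                  exact this
              have hone : {x ∈ heavy | i ∈ lastPositions l k x} ⊆ {x} := by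
                intro z hz
                obtain ⟨hzH, hzL⟩ := Finset.mem_filter.1 hz
                have hze := (mem_lastPositions.1 hzL).1
                rw [hxy, Sym2.mem_iff] at hze
                rcases hze with rfl | rfl
                · simp
                · exact absurd hzH hy
              have := Finset.card_le_card hone
              simp only [hmix, if_true]
              simpa using this
      _ = mixed.card + 2 * inside.card := by
          simp [Finset.sum_add_distrib, mul_comm]
  have hheavy_le : heavy.card ≤ mixed.card := by nlinarith
  have hgood : mixed.card + light.card ≤
      (goodPositions l k).card := by
    rw [← Finset.card_union_of_disjoint]
    · refine Finset.card_le_card fun i hi => ?_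
      rw [mem_goodPositions]
      rcases Finset.mem_union.1 hi with hi | hi
      · exact (Finset.mem_filter.1 hi).2.1
      · exact fun x hx => (dAfter_le_card i x).trans
          (not_lt.1 (mt (mem_heavy x).2 ((Finset.mem_filter.1 hi).2 x hx)))
    · rw [Finset.disjoint_left]
      intro i hi hi'
      obtain ⟨x, hx, hxH⟩ := (Finset.mem_filter.1 hi).2.2
      exact (Finset.mem_filter.1 hi').2 x hx hxH
  have hcover : T.card ≤ heavy.card + light.card := by
    have h1 : {a ∈ T | ∃ x ∈ a, x ∈ heavy}.card ≤ heavy.card := by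
      refine Finset.card_le_card_of_forall_subsingleton (fun a x => x ∈ a) (fun a ha => ?_)
        (fun x _ a ha b hb => ?_)
      · obtain ⟨x, hxa, hxH⟩ := (Finset.mem_filter.1 ha).2
        exact ⟨x, hxH, hxa⟩
      · exact hT.2 a (Finset.mem_filter.1 ha.1).1 b (Finset.mem_filter.1 hb.1).1 x ha.2 hb.2
    have h2 : {a ∈ T | ¬ ∃ x ∈ a, x ∈ heavy}.card ≤ light.card := by
      refine le_trans (Finset.card_le_card ?_) (Finset.card_image_le (s := light) (f := l.get))
      intro a ha
      obtain ⟨haT, haH⟩ := Finset.mem_filter.1 ha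
      obtain ⟨i, rfl⟩ := List.mem_iff_get.1 ((h.2 a).2 (hT.1 a haT))
      refine Finset.mem_image.2 ⟨i, ?_, rfl⟩
      simpa [hlight] using haH
    rw [← Finset.card_filter_add_card_filter_not (s := T) (fun a => ∃ x ∈ a, x ∈ heavy)]
    omega
  omega

/-- In a graph of arboricity at most `c` whose maximum matchings have `M` edges, there are at most
`(k + c + 2) * M` edges that are `k`-good. -/
lemma IsEdgeStream.card_good_le [Finite V] (h : IsEdgeStream G l) {c k M : ℕ}
    (harb : ArboricityLE G c) (hM : MaxMatchingSize G M) :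
    (goodPositions l k).card ≤ (k + c + 2) * M := by
  classical
  rcases isEmpty_or_nonempty V with hV | hV
  · have : IsEmpty (Fin l.length) := ⟨fun i => (l.get i).ind fun x _ => hV.false x⟩
    simp [Finset.eq_empty_of_isEmpty]
  obtain ⟨T, hT, rfl⟩ := hM.exists_card_eq
  choose! u w huw hw using fun a (ha : a ∈ T) => hT.exists_atMostOneExposedNeighbor hM ha
  set near : Finset (Fin l.length) := (T.image u).biUnion (lastPositions l k)
  set inside : Finset (Fin l.length) := positionsInside l (T.image w)
  set leaving : Finset (Fin l.length) :=
    {i | ∃ a ∈ T, ∃ z, l.get i = s(w a, z) ∧ ∀ b ∈ T, z ∉ b}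
  have hnear : near.card ≤ (k + 1) * T.card := by
    refine (Finset.card_biUnion_le_card_mul _ _ (k + 1) fun x _ =>
      card_lastPositions_le k x).trans ?_
    rw [mul_comm]
    exact Nat.mul_le_mul_left _ Finset.card_image_le
  have hinside : inside.card ≤ c * T.card :=
    (h.card_positionsInside_le harb _).trans (Nat.mul_le_mul_left _ Finset.card_image_le)
  have hleaving : leaving.card ≤ T.card := by
    refine Finset.card_le_card_of_forall_subsingleton
      (fun i a => ∃ z, l.get i = s(w a, z) ∧ ∀ b ∈ T, z ∉ b)
      (fun i hi => (Finset.mem_filter.1 hi).2) ?_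
    rintro a ha i ⟨-, z, hiz, hz⟩ j ⟨-, z', hjz, hz'⟩
    have hadj : G.Adj (w a) z := by
      rw [← mem_edgeSet, ← hiz]
      exact h.get_mem_edgeSet i
    have hadj' : G.Adj (w a) z' := by
      rw [← mem_edgeSet, ← hjz]
      exact h.get_mem_edgeSet j
    apply h.get_injective
    rw [hiz, hjz, hw a ha z z' hz hz' hadj hadj']
  have hcover : goodPositions l k ⊆
      near ∪ (inside ∪ leaving) := by
    intro i hi
    rw [mem_goodPositions] at hi
    by_cases hU : ∃ x ∈ l.get i, x ∈ T.image u
    · obtain ⟨x, hx, hxU⟩ := hU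
      exact Finset.mem_union_left _
        (Finset.mem_biUnion.2 ⟨x, hxU, mem_lastPositions.2 ⟨hx, hi x hx⟩⟩)
    refine Finset.mem_union_right _ ?_
    have hend : ∀ x ∈ l.get i, (∀ b ∈ T, x ∉ b) ∨ ∃ a ∈ T, w a = x := by
      intro x hx
      by_contra! hcon
      obtain ⟨⟨b, hb, hxb⟩, hne⟩ := hcon
      rw [huw b hb, Sym2.mem_iff] at hxb
      rcases hxb with rfl | rfl
      · exact hU ⟨_, hx, Finset.mem_image_of_mem u hb⟩
      · exact hne b hb rfl
    obtain ⟨p, q, hpq⟩ : ∃ p q, l.get i = s(p, q) := (l.get i).ind (fun p q => ⟨p, q, rfl⟩)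
    have hadj : G.Adj p q := by
      rw [← mem_edgeSet, ← hpq]
      exact h.get_mem_edgeSet i
    rcases hend p (hpq ▸ Sym2.mem_mk_left p q) with hp | ⟨a, ha, rfl⟩ <;>
      rcases hend q (hpq ▸ Sym2.mem_mk_right _ q) with hq | ⟨b, hb, rfl⟩
    · exact absurd hadj (hT.not_adj_of_exposed hM hp hq)
    · exact Finset.mem_union_right _
        (Finset.mem_filter.2 ⟨Finset.mem_univ _, b, hb, p, hpq.trans Sym2.eq_swap, hp⟩)
    · exact Finset.mem_union_right _
        (Finset.mem_filter.2 ⟨Finset.mem_univ _, a, ha, q, hpq, hq⟩)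
    · refine Finset.mem_union_left _ (mem_positionsInside.2 fun x hx => ?_)
      rw [hpq, Sym2.mem_iff] at hx
      rcases hx with rfl | rfl
      exacts [Finset.mem_image_of_mem w ha, Finset.mem_image_of_mem w hb]
  have h1 := Finset.card_le_card hcover
  have h2 := Finset.card_union_le near (inside ∪ leaving)
  have h3 := Finset.card_union_le inside leaving
  nlinarith

lemma EalphaCard_natCast (k : ℕ) : EalphaCard l (k : ℝ) =
    (goodPositions l k).card := by
  rw [EalphaCard, ← Set.ncard_coe_finset]
  simp [alphaGood_natCast_iff, goodPositions]

end Stream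

theorem statement_5 {V : Type*} [Fintype V] (G : SimpleGraph V)
    (c M : ℕ) (hc : 1 ≤ c) (harb : ArboricityLE G c)
    (l : List (Sym2 V)) (hstream : IsEdgeStream G l)
    (hM : MaxMatchingSize G M) :
    (M : ℝ) ≤ 3 * (EalphaCard l (6 * (c : ℝ)) : ℝ) ∧
      3 * (EalphaCard l (6 * (c : ℝ)) : ℝ) ≤ (22.5 * c + 6) * M := by
  classical
  have hE : EalphaCard l (6 * (c : ℝ)) =
      (goodPositions l (6 * c)).card := by
    rw [← EalphaCard_natCast]
    norm_num
  have hlow : M ≤ EalphaCard l (6 * (c : ℝ)) :=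
    hE ▸ hstream.maxMatchingSize_le_card_good harb hM (by omega)
  have hup : EalphaCard l (6 * (c : ℝ)) ≤ (6 * c + c + 2) * M :=
    hE ▸ hstream.card_good_le harb hM
  have hlow' : (M : ℝ) ≤ (EalphaCard l (6 * (c : ℝ)) : ℝ) := by exact_mod_cast hlow
  have hup' : (EalphaCard l (6 * (c : ℝ)) : ℝ) ≤ (6 * c + c + 2) * M := by exact_mod_cast hup
  have hM0 : (0 : ℝ) ≤ M := Nat.cast_nonneg M
  have hcM : (0 : ℝ) ≤ c * M := by positivity
  constructor <;> nlinarith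
end

section
/- Let G = (V,E) be a finite simple graph with arboricity at most c, let μ > 2c be an integer, let H be the set of vertices of degree greater than μ, and let H_1 ⊆ H be the vertices of H having at least one neighbor of degree at most μ. For v ∈ H, let d_H(v) denote the degree of v in the subgraph induced on H. Then at least half of the vertices v ∈ H_1 satisfy d_H(v) ≤ 4c(μ+1)/(μ+1−2c). -/
open SimpleGraph

variable {V : Type*}

open Finset in
theorem SimpleGraph.IsAcyclic.card_edgeFinset_le_s8 {W : Type*} [Fintype W] {F : SimpleGraph W}
    [Fintype F.edgeSet] (hF : F.IsAcyclic) : #F.edgeFinset ≤ Fintype.card W := by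
  classical
  rcases isEmpty_or_nonempty W with hW | hW
  · rw [card_eq_zero.mpr (eq_empty_of_isEmpty _)]
    exact Nat.zero_le _
  · obtain ⟨T, hFT, -, hT⟩ :=
      (connected_top (V := W)).exists_isTree_le_of_le_of_isAcyclic le_top hF
    have hle : #F.edgeFinset ≤ #T.edgeFinset := card_le_card (edgeFinset_mono hFT)
    have hcard := hT.card_edgeFinset
    lia

open Finset in
theorem SimpleGraph.IsAcyclic.sum_card_filter_adj_le {W : Type*} {F : SimpleGraph W}
    [DecidableRel F.Adj] (hF : F.IsAcyclic) (s : Finset W) :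
    ∑ v ∈ s, #{w ∈ s | F.Adj v w} ≤ 2 * #s := by
  classical
  let K : SimpleGraph s := F.comap (Function.Embedding.subtype _)
  have hK : K.IsAcyclic := hF.of_comap _
  have hdeg (v : s) : #{w ∈ s | F.Adj v w} = K.degree v := by
    rw [← card_neighborFinset_eq_degree, ← card_map (Function.Embedding.subtype (· ∈ s))]
    congr 1
    ext w
    simp only [mem_filter, mem_map, mem_neighborFinset, Function.Embedding.subtype_apply]
    exact ⟨fun h ↦ ⟨⟨w, h.1⟩, h.2, rfl⟩, fun ⟨x, hx, hxw⟩ ↦ hxw ▸ ⟨x.2, hx⟩⟩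
  calc ∑ v ∈ s, #{w ∈ s | F.Adj v w}
      = ∑ v : s, K.degree v := by
        rw [← sum_coe_sort]
        exact sum_congr rfl fun v _ ↦ hdeg v
    _ = 2 * #K.edgeFinset := K.sum_degrees_eq_twice_card_edges
    _ ≤ 2 * #s := by
        have := hK.card_edgeFinset_le_s8
        rw [Fintype.card_coe] at this
        lia

open Finset in
theorem ArboricityLE.sum_card_filter_adj_le {W : Type*} {G : SimpleGraph W}
    [DecidableRel G.Adj] {c : ℕ} (hG : ArboricityLE G c) (s : Finset W) :
    ∑ v ∈ s, #{w ∈ s | G.Adj v w} ≤ 2 * c * #s := by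
  classical
  obtain ⟨F, hF, -, hcover⟩ := hG
  calc ∑ v ∈ s, #{w ∈ s | G.Adj v w}
      ≤ ∑ v ∈ s, ∑ i, #{w ∈ s | (F i).Adj v w} := by
        refine sum_le_sum fun v _ ↦ le_trans (card_le_card fun w hw ↦ ?_) card_biUnion_le
        obtain ⟨hw, hadj⟩ := mem_filter.mp hw
        obtain ⟨i, hi⟩ := hcover hadj
        exact mem_biUnion.mpr ⟨i, mem_univ i, mem_filter.mpr ⟨hw, hi⟩⟩
    _ = ∑ i, ∑ v ∈ s, #{w ∈ s | (F i).Adj v w} := sum_comm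
    _ ≤ ∑ _i : Fin c, 2 * #s := sum_le_sum fun i _ ↦ (hF i).sum_card_filter_adj_le s
    _ = 2 * c * #s := by simp; ring

open Finset in
/-- The vertices of `s` with all their neighbors in `s` have high degree inside `s`, so the degree
sum inside `s` over the remaining vertices is small. -/
theorem ArboricityLE.sum_card_filter_adj_boundary_le {W : Type*} [Fintype W] {G : SimpleGraph W}
    [DecidableRel G.Adj] {c μ : ℕ} (hG : ArboricityLE G c) (hμ : 2 * c < μ) {s t : Finset W}
    (hts : t ⊆ s) (hdeg : ∀ v ∈ s, μ < G.degree v)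
    (hint : ∀ v ∈ s, v ∉ t → ∀ w, G.Adj v w → w ∈ s) :
    ∑ v ∈ t, #{w ∈ s | G.Adj v w} ≤ 2 * c * #t := by
  classical
  have hsum := hG.sum_card_filter_adj_le s
  rw [← sum_sdiff hts, ← card_sdiff_add_card_eq_card hts] at hsum
  have hlow : #(s \ t) * (2 * c) ≤ ∑ v ∈ s \ t, #{w ∈ s | G.Adj v w} := by
    rw [← smul_eq_mul]
    refine card_nsmul_le_sum _ _ _ fun v hv ↦ ?_
    obtain ⟨hvs, hvt⟩ := mem_sdiff.mp hv
    have hfull : {w ∈ s | G.Adj v w} = G.neighborFinset v := by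
      ext w
      simpa using hint v hvs hvt w
    rw [hfull, card_neighborFinset_eq_degree]
    exact (hμ.trans (hdeg v hvs)).le
  nlinarith

theorem statement_8 {V : Type*} [Fintype V] (G : SimpleGraph V) [DecidableRel G.Adj]
    (c μ : ℕ) (harb : ArboricityLE G c) (hμ : 2 * c < μ) :
    ({v : V | μ < G.degree v ∧ ∃ w, G.Adj v w ∧ G.degree w ≤ μ}.ncard : ℝ) ≤
      2 * ({v : V | (μ < G.degree v ∧ ∃ w, G.Adj v w ∧ G.degree w ≤ μ) ∧
            ({w : V | G.Adj v w ∧ μ < G.degree w}.ncard : ℝ) ≤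
              4 * c * (μ + 1) / (μ + 1 - 2 * c)}.ncard : ℝ) := by
  classical
  let H : Finset V := {v | μ < G.degree v}
  let H₁ : Finset V := {v | μ < G.degree v ∧ ∃ w, G.Adj v w ∧ G.degree w ≤ μ}
  let d (v : V) : ℕ := Finset.card {w ∈ H | G.Adj v w}
  have hd (v : V) : {w : V | G.Adj v w ∧ μ < G.degree w}.ncard = d v := by
    rw [show d v = _ from (Set.ncard_coe_finset _).symm]
    congr 1
    ext w
    simp [H, and_comm]
  have hthreshold : (4 * c : ℝ) ≤ 4 * c * (μ + 1) / (μ + 1 - 2 * c) := by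
    have hμ' : (2 * c : ℝ) < μ := by exact_mod_cast hμ
    have hc : (0 : ℝ) ≤ c := c.cast_nonneg
    rw [le_div_iff₀ (by linarith)]
    nlinarith
  have hsum : ∑ v ∈ H₁, d v ≤ 2 * c * H₁.card := by
    refine harb.sum_card_filter_adj_boundary_le hμ (fun v hv ↦ ?_) (fun v hv ↦ ?_)
      fun v hv hv₁ w hw ↦ ?_
    · simp only [H₁, H, Finset.mem_filter_univ] at hv ⊢
      exact hv.1
    · simpa [H] using hv
    · simp only [H₁, H, Finset.mem_filter_univ] at hv hv₁ ⊢
      by_contra! hle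
      exact hv₁ ⟨hv, w, hw, hle⟩
  have hmarkov : (4 * c + 1) * Finset.card {v ∈ H₁ | ¬ d v ≤ 4 * c} ≤ 2 * c * H₁.card := by
    refine le_trans ?_ hsum
    refine le_trans ?_ <| Finset.sum_le_sum_of_subset <|
      Finset.filter_subset (fun v ↦ ¬ d v ≤ 4 * c) H₁
    rw [mul_comm, ← smul_eq_mul]
    refine Finset.card_nsmul_le_sum _ _ _ fun v hv ↦ ?_
    have := (Finset.mem_filter.mp hv).2
    lia
  have hsplit := H₁.card_filter_add_card_filter_not (p := fun v ↦ d v ≤ 4 * c)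
  have hhalf : H₁.card ≤ 2 * Finset.card {v ∈ H₁ | d v ≤ 4 * c} := by
    by_contra! hlt
    nlinarith
  have hleft : {v : V | μ < G.degree v ∧ ∃ w, G.Adj v w ∧ G.degree w ≤ μ}.ncard = H₁.card := by
    rw [← Set.ncard_coe_finset]
    simp [H₁]
  have hright : Finset.card {v ∈ H₁ | d v ≤ 4 * c} ≤
      {v : V | (μ < G.degree v ∧ ∃ w, G.Adj v w ∧ G.degree w ≤ μ) ∧
        ({w : V | G.Adj v w ∧ μ < G.degree w}.ncard : ℝ) ≤
          4 * c * (μ + 1) / (μ + 1 - 2 * c)}.ncard := by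
    rw [← Set.ncard_coe_finset]
    refine Set.ncard_le_ncard (fun v hv ↦ ?_) (Set.toFinite _)
    obtain ⟨hv₁, hvd⟩ := Finset.mem_filter.mp (Finset.mem_coe.mp hv)
    refine ⟨by simpa [H₁] using hv₁, ?_⟩
    rw [hd]
    exact le_trans (by exact_mod_cast hvd) hthreshold
  rw [hleft]
  exact_mod_cast hhalf.trans (Nat.mul_le_mul_left 2 hright)
end

section
/- Let S = (e_1, …, e_m) be any ordering (stream) of the edges of a finite simple graph G, let μ be a positive integer, and let v be a vertex of degree greater than μ that has at least one neighbor of degree at most μ. Let e_i = (v,u) be the last edge of S joining v to a neighbor u of degree at most μ. Then e_i is α-good with respect to S for α = max{μ − 1, d_H(v)}, where d_H(v) is the degree of v in the subgraph induced on the set of vertices of degree greater than μ. -/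
open SimpleGraph

variable {V : Type*}

/-- If every edge at `x` after position `i` joins `x` to a vertex of `T`, then at most `T.ncard`
edges at `x` appear after position `i`. -/
theorem dAfter_le_ncard {V : Type*} {l : List (Sym2 V)} (hl : l.Nodup) (i : ℕ) (x : V)
    {T : Set V} (hT : T.Finite)
    (h : ∀ j : Fin l.length, i < (j : ℕ) → ∀ w, l.get j = s(x, w) → w ∈ T) :
    dAfter l i x ≤ T.ncard := by
  have hex : ∀ j : Fin l.length, ∃ w, x ∈ l.get j → l.get j = s(x, w) := fun j => by
    by_cases hx : x ∈ l.get j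
    · obtain ⟨w, hw⟩ := Sym2.mem_iff_exists.mp hx
      exact ⟨w, fun _ => hw⟩
    · exact ⟨x, fun hx' => absurd hx' hx⟩
  choose f hf using hex
  refine Set.ncard_le_ncard_of_injOn f (fun j hj => h j hj.1 _ (hf j hj.2)) ?_ hT
  intro j hj k hk hjk
  apply List.nodup_iff_injective_get.mp hl
  rw [hf j hj.2, hf k hk.2, hjk]

theorem statement_9 {V : Type*} [Fintype V] (G : SimpleGraph V) [DecidableRel G.Adj]
    (μ : ℕ) (hμ : 0 < μ)
    (l : List (Sym2 V)) (hstream : IsEdgeStream G l)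
    (v u : V) (i : Fin l.length)
    (hv : μ < G.degree v) (hu : G.degree u ≤ μ)
    (hi : l.get i = s(v, u))
    (hlast : ∀ j : Fin l.length, (i : ℕ) < (j : ℕ) →
      ∀ w, l.get j = s(v, w) → μ < G.degree w) :
    AlphaGood l (max ((μ : ℝ) - 1)
      (({w : V | G.Adj v w ∧ μ < G.degree w}.ncard : ℝ))) i := by
  obtain ⟨hnd, hmem⟩ := hstream
  have hadj : ∀ (j : Fin l.length) (x w : V), l.get j = s(x, w) → G.Adj x w := fun j x w h =>
    (hmem s(x, w)).mp (h ▸ l.get_mem j)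
  intro x hx
  rw [hi, Sym2.mem_iff] at hx
  obtain rfl | rfl := hx
  · refine le_max_of_le_right (Nat.cast_le.mpr ?_)
    exact dAfter_le_ncard hnd i x (Set.toFinite _) fun j hj w hw =>
      ⟨hadj j x w hw, hlast j hj w hw⟩
  · refine le_max_of_le_left ?_
    have hle : dAfter l i x ≤ (G.neighborSet x \ {v}).ncard := by
      refine dAfter_le_ncard hnd i x (Set.toFinite _) fun j hj w hw => ⟨hadj j x w hw, ?_⟩
      rintro rfl
      have hji : j = i := List.nodup_iff_injective_get.mp hnd (by rw [hw, hi, Sym2.eq_swap])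
      exact hj.ne' (congrArg Fin.val hji)
    have hcard : (G.neighborSet x \ {v}).ncard + 1 = G.degree x := by
      rw [Set.ncard_sdiff_singleton_add_one (show v ∈ G.neighborSet x from (hadj i v x hi).symm),
        Set.ncard_eq_toFinset_card', Set.toFinset_card, G.card_neighborSet_eq_degree]
    have hlt : dAfter l i x + 1 ≤ μ := by lia
    rw [le_sub_iff_add_le]
    exact_mod_cast hlt
end

section
/- Let S = (e_1, …, e_m) be any ordering (stream) of the edges of a finite simple graph G, let α ≥ 0, and let E_α be the set of α-good edges of S. Then in the subgraph of G whose edge set is E_α, every vertex has degree at most α + 1. -/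
open SimpleGraph

variable {V : Type*}

theorem statement_10 {V : Type*} [Fintype V] (G : SimpleGraph V)
    (l : List (Sym2 V)) (hstream : IsEdgeStream G l)
    (α : ℝ) (hα : 0 ≤ α) (x : V) :
    ({i : Fin l.length | AlphaGood l α i ∧ x ∈ l.get i}.ncard : ℝ) ≤ α + 1 := by
  rcases Set.eq_empty_or_nonempty {i : Fin l.length | AlphaGood l α i ∧ x ∈ l.get i} with h | h
  · rw [h, Set.ncard_empty]
    push_cast
    linarith
  · obtain ⟨i, ⟨hgood, hx⟩, hmin⟩ := Set.exists_min_image _ id (Set.toFinite _) h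
    have hsub : {i : Fin l.length | AlphaGood l α i ∧ x ∈ l.get i} ⊆
        insert i {j : Fin l.length | (i : ℕ) < (j : ℕ) ∧ x ∈ l.get j} := by
      intro j hj
      rcases (show i ≤ j from hmin j hj).eq_or_lt with hij | hij
      · exact Or.inl hij.symm
      · exact Or.inr ⟨hij, hj.2⟩
    have hcard := (Set.ncard_le_ncard hsub (Set.toFinite _)).trans (Set.ncard_insert_le _ _)
    calc ({i : Fin l.length | AlphaGood l α i ∧ x ∈ l.get i}.ncard : ℝ)
        ≤ (dAfter l (i : ℕ) x : ℝ) + 1 := by exact_mod_cast hcard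
      _ ≤ α + 1 := by linarith [hgood x hx]
end

section
/- Let T be a finite tree (more generally, a forest), let S be any ordering (stream) of its edges, let M* be the size of a maximum matching of T, and let E_1 be the set of 1-good edges of S. Then |E_1| ≤ 2·M*. -/
open SimpleGraph

variable {V : Type*}

/-- An acyclic graph with finitely many, and at least one, edges has a leaf. -/
lemma SimpleGraph.IsAcyclic.exists_adj_forall_adj_eq {V : Type*} {G : SimpleGraph V}
    [Finite G.edgeSet] (h : G.IsAcyclic) {a b : V} (hab : G.Adj a b) :
    ∃ u w, G.Adj u w ∧ ∀ x, G.Adj u x → x = w := by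
  have : Nonempty V := ⟨a⟩
  obtain ⟨u, v, p, hp, hmax⟩ := Walk.exists_isPath_forall_isPath_length_le_length G
  have hlen : 1 ≤ p.length :=
    hmax a b (Walk.cons hab Walk.nil) (by simp [Walk.cons_isPath_iff, hab.ne])
  have hnil : ¬p.Nil := by
    rw [← Walk.length_eq_zero_iff]
    lia
  refine ⟨u, _, p.adj_snd hnil, fun x hadj ↦ h.eq_snd_of_adj_start hp hadj ?_⟩
  by_contra hx
  have hle := hmax _ _ _ (hp.cons hx (h := hadj.symm))
  rw [Walk.length_cons] at hle
  lia

open Classical in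
/-- A finite set of edges of an acyclic graph in which every vertex meets at most two edges
contains a set of pairwise disjoint edges of at least half its size. -/
lemma SimpleGraph.IsAcyclic.exists_pairwise_disjoint_card_le_two_mul {V : Type*}
    {G : SimpleGraph V} (h : G.IsAcyclic) (E : Finset (Sym2 V)) (hE : ∀ e ∈ E, e ∈ G.edgeSet)
    (hdeg : ∀ v, (E.filter (v ∈ ·)).card ≤ 2) :
    ∃ N ⊆ E, (∀ e ∈ N, ∀ f ∈ N, ∀ v, v ∈ e → v ∈ f → e = f) ∧ E.card ≤ 2 * N.card := by
  induction E using Finset.strongInduction with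
  | H E ih =>
    obtain rfl | ⟨⟨a, b⟩, he⟩ := E.eq_empty_or_nonempty
    · exact ⟨∅, by simp⟩
    have hadj : ∀ x y, (fromEdgeSet (E : Set (Sym2 V))).Adj x y ↔ s(x, y) ∈ E := fun x y ↦ by
      simp only [fromEdgeSet_adj, Finset.mem_coe, and_iff_left_iff_imp]
      exact fun hxy ↦ (show G.Adj x y from hE _ hxy).ne
    have hacyc : (fromEdgeSet (E : Set (Sym2 V))).IsAcyclic :=
      h.anti fun x y hxy ↦ hE _ ((hadj x y).1 hxy)
    have : Finite (fromEdgeSet (E : Set (Sym2 V))).edgeSet := by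
      rw [edgeSet_fromEdgeSet]
      exact (E.finite_toSet.subset Set.sdiff_subset).to_subtype
    obtain ⟨u, w, huw, hleaf⟩ := hacyc.exists_adj_forall_adj_eq ((hadj a b).2 he)
    rw [hadj] at huw
    have hleaf' : ∀ e ∈ E, u ∈ e → e = s(u, w) := by
      intro e he' hu
      obtain ⟨x, rfl⟩ := hu
      rw [hleaf x ((hadj u x).2 he')]
    obtain ⟨N, hNE, hN, hcard⟩ := ih (E.filter (w ∉ ·))
      (Finset.filter_ssubset.2 ⟨_, huw, by simp⟩)
      (fun e he' ↦ hE e (Finset.mem_filter.1 he').1)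
      (fun v ↦ (Finset.card_le_card
        (Finset.filter_subset_filter _ (Finset.filter_subset _ _))).trans (hdeg v))
    have hdisj : ∀ e ∈ N, ∀ v ∈ e, v ∉ s(u, w) := by
      intro e heN v hve hv
      obtain ⟨heE, hwe⟩ := Finset.mem_filter.1 (hNE heN)
      obtain rfl | rfl := Sym2.mem_iff.1 hv
      · rw [hleaf' e heE hve] at hwe
        simp at hwe
      · exact hwe hve
    have hnotin : s(u, w) ∉ N := fun hmem ↦ hdisj _ hmem u (by simp) (by simp)
    refine ⟨insert s(u, w) N, ?_, ?_, ?_⟩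
    · exact Finset.insert_subset huw (hNE.trans (Finset.filter_subset _ _))
    · intro e he' f hf v hve hvf
      rw [Finset.mem_insert] at he' hf
      rcases he' with rfl | he' <;> rcases hf with rfl | hf
      · rfl
      · exact (hdisj f hf v hvf hve).elim
      · exact (hdisj e he' v hve hvf).elim
      · exact hN e he' f hf v hve hvf
    · rw [Finset.card_insert_of_notMem hnotin]
      have hsplit := Finset.card_filter_add_card_filter_not (s := E) (w ∈ ·)
      have := hdeg w
      lia

/-- A set of pairwise disjoint edges of `G` is the edge set of a matching. -/
lemma SimpleGraph.exists_isMatching_edgeSet_eq {V : Type*} {G : SimpleGraph V}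
    (N : Set (Sym2 V)) (hN : N ⊆ G.edgeSet)
    (hdisj : ∀ e ∈ N, ∀ f ∈ N, ∀ v, v ∈ e → v ∈ f → e = f) :
    ∃ H : G.Subgraph, H.IsMatching ∧ H.edgeSet = N := by
  refine ⟨{ verts := {v | ∃ e ∈ N, v ∈ e}
            Adj := fun x y ↦ s(x, y) ∈ N
            adj_sub := fun hxy ↦ hN hxy
            edge_vert := fun hxy ↦ ⟨_, hxy, by simp⟩
            symm := ⟨fun x y hxy ↦ by rwa [Sym2.eq_swap]⟩ }, ?_, ?_⟩
  · rintro v ⟨e, he, x, rfl⟩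
    exact ⟨x, he, fun y hy ↦ Sym2.congr_right.1 (hdisj _ hy _ he v (by simp) (by simp))⟩
  · ext ⟨x, y⟩
    rfl

open Classical in
/-- Every vertex meets at most two `1`-good edges. -/
lemma card_alphaGood_one_mem_le_two {V : Type*} (l : List (Sym2 V)) (v : V) :
    (Finset.univ.filter fun i : Fin l.length ↦ AlphaGood l 1 i ∧ v ∈ l.get i).card ≤ 2 := by
  set s := Finset.univ.filter fun i : Fin l.length ↦ AlphaGood l 1 i ∧ v ∈ l.get i with hs
  obtain h | hne := s.eq_empty_or_nonempty
  · simp [h]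
  obtain ⟨hgood, hv⟩ := (Finset.mem_filter.1 (s.min'_mem hne)).2
  have hd : dAfter l (s.min' hne : ℕ) v ≤ 1 := by exact_mod_cast hgood v hv
  have hle : (s.erase (s.min' hne)).card ≤ dAfter l (s.min' hne : ℕ) v := by
    rw [dAfter, ← Set.ncard_coe_finset]
    refine Set.ncard_le_ncard (fun j hj ↦ ?_) (Set.toFinite _)
    rw [Finset.mem_coe] at hj
    exact ⟨s.min'_lt_of_mem_erase_min' hne hj,
      (Finset.mem_filter.1 (Finset.mem_of_mem_erase hj)).2.2⟩
  rw [Finset.card_erase_of_mem (s.min'_mem hne)] at hle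
  lia

theorem statement_11 {V : Type*} [Fintype V] (T : SimpleGraph V) (hT : T.IsAcyclic)
    (l : List (Sym2 V)) (hstream : IsEdgeStream T l)
    (M : ℕ) (hM : MaxMatchingSize T M) :
    EalphaCard l 1 ≤ 2 * M := by
  classical
  obtain ⟨hnodup, hmem⟩ := hstream
  have hinj : Function.Injective l.get := List.nodup_iff_injective_get.1 hnodup
  let s := Finset.univ.filter fun i : Fin l.length ↦ AlphaGood l 1 i
  have hs : EalphaCard l 1 = (s.image l.get).card := by
    rw [Finset.card_image_of_injective _ hinj, EalphaCard, ← Set.ncard_coe_finset]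
    simp [s]
  have hE : ∀ e ∈ s.image l.get, e ∈ T.edgeSet := by
    intro e he
    obtain ⟨i, -, rfl⟩ := Finset.mem_image.1 he
    exact (hmem _).1 (l.get_mem i)
  have hdeg : ∀ v, ((s.image l.get).filter (v ∈ ·)).card ≤ 2 := by
    intro v
    rw [Finset.filter_image, Finset.card_image_of_injective _ hinj, Finset.filter_filter]
    exact card_alphaGood_one_mem_le_two l v
  obtain ⟨N, hNE, hN, hcard⟩ := hT.exists_pairwise_disjoint_card_le_two_mul _ hE hdeg
  obtain ⟨H, hH, hHN⟩ := exists_isMatching_edgeSet_eq (G := T) (N : Set (Sym2 V))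
    (fun e he ↦ hE e (hNE he)) hN
  have hle := hM.2 H hH
  rw [hHN, Set.ncard_coe_finset] at hle
  lia
end

section
/- Let T be a finite tree (more generally, a forest), let S be any ordering (stream) of its edges, let M* be the size of a maximum matching of T, and let E_1 be the set of 1-good edges of S. Then M* ≤ |E_1|. -/
open SimpleGraph

variable {V : Type*}

open Finset in
/-- In a finite linear order, at least `min 2 #A` elements of `A` have at most one larger element
in `A`. -/
theorem min_two_card_le_card_filter_card_gt_le_one {ι : Type*} [LinearOrder ι] (A : Finset ι) :
    min 2 #A ≤ #{i ∈ A | #{j ∈ A | i < j} ≤ 1} := by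
  rcases A.eq_empty_or_nonempty with rfl | hA
  · simp
  have ha := A.max'_mem hA
  have hle : ∀ j ∈ A, j ≤ A.max' hA := fun j hj => A.le_max' j hj
  generalize A.max' hA = a at ha hle
  have ha' : a ∈ {i ∈ A | #{j ∈ A | i < j} ≤ 1} := by
    rw [mem_filter]
    refine ⟨ha, ?_⟩
    rw [filter_false_of_mem fun j hj => not_lt.2 (hle j hj)]
    simp
  rcases (A.erase a).eq_empty_or_nonempty with h | hB
  · have h1 : #A - 1 = 0 := by rw [← card_erase_of_mem ha, h, card_empty]
    have := card_pos.2 ⟨a, ha'⟩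
    omega
  have hb := (A.erase a).max'_mem hB
  have hble : ∀ j ∈ A.erase a, j ≤ (A.erase a).max' hB := fun j hj => (A.erase a).le_max' j hj
  generalize (A.erase a).max' hB = b at hb hble
  have hb' : b ∈ {i ∈ A | #{j ∈ A | i < j} ≤ 1} := by
    rw [mem_filter]
    refine ⟨mem_of_mem_erase hb, (card_le_card (t := {a}) ?_).trans (card_singleton a).le⟩
    intro j hj
    rw [mem_filter] at hj
    by_contra hja
    exact not_lt.2 (hble j (mem_erase.2 ⟨by simpa using hja, hj.1⟩)) hj.2
  have h2 : #({a, b} : Finset ι) = 2 := card_pair (ne_of_mem_erase hb).symm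
  have := card_le_card (s := {a, b}) (insert_subset ha' (singleton_subset_iff.2 hb'))
  omega

/-- A finite forest has at most `|V| - c` edges, where `c` is its number of components. -/
theorem SimpleGraph.IsAcyclic.ncard_edgeSet_add_card_connectedComponent_le {V : Type*} [Finite V]
    {G : SimpleGraph V} (hG : G.IsAcyclic) :
    G.edgeSet.ncard + Nat.card G.ConnectedComponent ≤ Nat.card V := by
  induction hk : G.edgeSet.ncard generalizing G with
  | zero =>
    rw [zero_add]
    exact Nat.card_le_card_of_surjective G.connectedComponentMk Quot.mk_surjective
  | succ k ih =>
    obtain ⟨e, he⟩ := Set.nonempty_of_ncard_ne_zero (hk.trans_ne k.succ_ne_zero)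
    induction e with | _ u v
    have hle : G.deleteEdges {s(u, v)} ≤ G := G.deleteEdges_le _
    have h := ih (hG.anti hle) (by
      rw [edgeSet_deleteEdges, Set.ncard_sdiff_singleton_of_mem he, hk, Nat.add_sub_cancel])
    have hnr : ¬ (G.deleteEdges {s(u, v)}).Reachable u v :=
      isBridge_iff.1 (isAcyclic_iff_forall_adj_isBridge.1 hG he)
    have hlt : Nat.card G.ConnectedComponent <
        Nat.card (G.deleteEdges {s(u, v)}).ConnectedComponent := by
      have hs := ConnectedComponent.surjective_map_ofLE hle
      refine lt_of_le_of_ne (Nat.card_le_card_of_surjective _ hs) fun heq => hnr ?_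
      have hinj := ((Nat.bijective_iff_surjective_and_card _).2 ⟨hs, heq.symm⟩).1
      refine ConnectedComponent.exact (hinj ?_)
      exact ConnectedComponent.sound (Adj.reachable he)
    omega

/-- If `x` and all its neighbors have at most one neighbor, then the component of `x` consists of
`x` and its neighbors. -/
theorem SimpleGraph.Reachable.eq_or_adj_of_forall_adj_unique {V : Type*} {G : SimpleGraph V}
    {x y : V} (h : G.Reachable x y)
    (hx : ∀ z, G.Adj x z → ∀ w, G.Adj z w → w = x) : y = x ∨ G.Adj x y := by
  obtain ⟨p⟩ := h.symm
  induction p with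
  | nil => exact Or.inl rfl
  | cons hadj p ih =>
    rcases ih (Walk.reachable p).symm hx with rfl | h'
    · exact Or.inr hadj.symm
    · exact Or.inl (hx _ h' _ hadj.symm)

/-- A matching `H` of a finite graph satisfies `|H| + #isolated ≤ |D| + #components`, for any
set of vertices `D` containing all vertices with at least two neighbors. -/
theorem SimpleGraph.Subgraph.IsMatching.ncard_edgeSet_add_ncard_isolated_le {V : Type*} [Finite V]
    {G : SimpleGraph V} {H : G.Subgraph} (hH : H.IsMatching) (D : Set V)
    (hD : ∀ x ∉ D, ∀ y z, G.Adj x y → G.Adj x z → y = z) :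
    H.edgeSet.ncard + {x | ∀ y, ¬ G.Adj x y}.ncard ≤
      D.ncard + Nat.card G.ConnectedComponent := by
  classical
  have hmatch : ∀ {x y z}, H.Adj x y → H.Adj x z → y = z := fun h h' =>
    (hH (H.edge_vert h)).unique h h'
  have heq : ∀ {e e' x}, e ∈ H.edgeSet → e' ∈ H.edgeSet → x ∈ e → x ∈ e' → e = e' := by
    rintro e e' x he he' ⟨y, rfl⟩ ⟨z, rfl⟩
    rw [hmatch (H.mem_edgeSet.1 he) (H.mem_edgeSet.1 he')]
  set A : Set (Sym2 V) := {e ∈ H.edgeSet | ∃ x ∈ e, x ∈ D} with hA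
  set B : Set (Sym2 V) := {e ∈ H.edgeSet | ∀ x ∈ e, x ∉ D} with hB
  set I : Set V := {x | ∀ y, ¬ G.Adj x y} with hI
  have hAB : H.edgeSet.ncard ≤ A.ncard + B.ncard := by
    refine le_trans (Set.ncard_le_ncard ?_) (Set.ncard_union_le A B)
    intro e he
    by_cases h : ∃ x ∈ e, x ∈ D
    · exact Or.inl ⟨he, h⟩
    · exact Or.inr ⟨he, by simpa using h⟩
  have hAD : A.ncard ≤ D.ncard := by
    have hex : ∀ e : A, ∃ x ∈ e.1, x ∈ D := fun e => e.2.2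
    choose f hf hfD using hex
    rw [← Nat.card_coe_set_eq, ← Nat.card_coe_set_eq]
    refine Nat.card_le_card_of_injective (fun e => (⟨f e, hfD e⟩ : D)) fun e e' h => ?_
    have h' : f e = f e' := congrArg Subtype.val h
    exact Subtype.ext (heq e.2.1 e'.2.1 (hf e) (h' ▸ hf e'))
  have hout : ∀ e : Sym2 V, e.out.1 ∈ e := fun e => e.out_fst_mem
  have hBI : B.ncard + I.ncard ≤ Nat.card G.ConnectedComponent := by
    rw [← Nat.card_coe_set_eq, ← Nat.card_coe_set_eq, ← Nat.card_sum]
    have hlight : ∀ e ∈ B, ∀ x ∈ e, ∀ y, G.Adj x y → s(x, y) = e ∧ y ∉ D := by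
      rintro e ⟨he, heD⟩ x ⟨z, rfl⟩ y hxy
      have : z = y := hD x (heD x (Sym2.mem_mk_left _ _)) _ _ (H.adj_sub he) hxy
      subst this
      exact ⟨rfl, heD _ (Sym2.mem_mk_right _ _)⟩
    have hreach : ∀ e ∈ B, ∀ x ∈ e, ∀ y, G.Reachable x y → y = x ∨ G.Adj x y := by
      intro e he x hx y hxy
      refine hxy.eq_or_adj_of_forall_adj_unique fun z hxz w hzw => ?_
      exact hD z (hlight e he x hx z hxz).2 _ _ hzw hxz.symm
    have hmem : ∀ e ∈ B, ∀ x ∈ e, ∀ y, G.Reachable x y → y ∈ e := by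
      intro e he x hx y hxy
      rcases hreach e he x hx y hxy with rfl | h
      · exact hx
      · exact (hlight e he x hx y h).1 ▸ Sym2.mem_mk_right _ _
    have hiso : ∀ e ∈ B, ∀ x ∈ e, x ∉ I := by
      rintro e ⟨he, -⟩ x ⟨z, rfl⟩ hx
      exact hx z (H.adj_sub he)
    refine Nat.card_le_card_of_injective
      (Sum.elim (fun e : B => G.connectedComponentMk e.1.out.1)
        (fun x : I => G.connectedComponentMk x.1)) (Function.Injective.sumElim ?_ ?_ ?_)
    · intro e e' h
      have := hmem e.1 e.2 _ (hout e.1) _ (ConnectedComponent.exact h)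
      exact Subtype.ext (heq e.2.1 e'.2.1 this (hout e'.1))
    · intro x y h
      rcases (ConnectedComponent.exact h).eq_or_adj_of_forall_adj_unique
        (fun z hz => (x.2 z hz).elim) with h | h
      · exact Subtype.ext h.symm
      · exact (x.2 _ h).elim
    · intro e x h
      exact hiso e.1 e.2 _ (hmem e.1 e.2 _ (hout e.1) _ (ConnectedComponent.exact h)) x.2
  omega

theorem statement_12 {V : Type*} [Fintype V] (T : SimpleGraph V) (hT : T.IsAcyclic)
    (l : List (Sym2 V)) (hstream : IsEdgeStream T l)
    (M : ℕ) (hM : MaxMatchingSize T M) :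
    M ≤ EalphaCard l 1 := by
  classical
  obtain ⟨⟨H, hH, rfl⟩, -⟩ := hM
  obtain ⟨hnd, hl⟩ := hstream
  let A : V → Finset (Fin l.length) := fun x => {i | x ∈ l.get i}
  have hdA : ∀ i x, dAfter l (i : Fin l.length) x = (A x |>.filter (i < ·)).card := by
    intro i x
    rw [dAfter, Set.ncard_eq_toFinset_card']
    congr 1
    ext j
    simp [A, and_comm]
  have hgood : ∀ i, AlphaGood l 1 i ↔ ∀ x ∈ l.get i, dAfter l i x ≤ 1 := by
    intro i
    simp only [AlphaGood, Nat.cast_le_one]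
  have hE : EalphaCard l 1 = (Finset.univ.filter fun i => AlphaGood l 1 i).card := by
    rw [EalphaCard, Set.ncard_eq_toFinset_card']
    congr 1
    ext j
    simp
  have hidx : ∀ {x y}, T.Adj x y → ∃ i, l.get i = s(x, y) := fun h =>
    List.mem_iff_get.1 ((hl _).2 h)
  have hm : T.edgeSet.ncard = l.length := by
    have : T.edgeSet = (l.toFinset : Set (Sym2 V)) := by
      ext e
      simp [hl]
    rw [this, Set.ncard_coe_finset, List.toFinset_card_of_nodup hnd]
  have hpicks : ∑ x : V, min 2 (A x).card ≤ l.length + EalphaCard l 1 := by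
    calc ∑ x : V, min 2 (A x).card
        ≤ ∑ x : V, (Finset.univ.filter fun i => x ∈ l.get i ∧ dAfter l i x ≤ 1).card := by
          refine Finset.sum_le_sum fun x _ =>
            (min_two_card_le_card_filter_card_gt_le_one (A x)).trans_eq ?_
          congr 1
          ext i
          simp [A, hdA]
      _ = ∑ i : Fin l.length, (Finset.univ.filter fun x => x ∈ l.get i ∧ dAfter l i x ≤ 1).card :=
          Finset.sum_card_bipartiteAbove_eq_sum_card_bipartiteBelow
            (fun x i => x ∈ l.get i ∧ dAfter l i x ≤ 1)
      _ ≤ ∑ i : Fin l.length, (1 + if AlphaGood l 1 i then 1 else 0) := by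
          refine Finset.sum_le_sum fun i _ => ?_
          rw [hgood]
          generalize l.get i = e
          induction e with | _ u v
          split_ifs with h
          · refine (Finset.card_le_card (t := {u, v}) ?_).trans Finset.card_le_two
            intro x
            simp +contextual
          · rw [add_zero, Finset.card_le_one]
            intro a ha b hb
            simp only [Finset.mem_filter, Finset.mem_univ, true_and, Sym2.mem_iff] at ha hb
            by_contra hab
            refine h fun x hx => ?_
            rw [Sym2.mem_iff] at hx
            grind
      _ = l.length + EalphaCard l 1 := by
          rw [Finset.sum_add_distrib, hE, Finset.card_filter]
          simp
  have hD : ∀ x ∉ {x | 2 ≤ (A x).card}, ∀ y z, T.Adj x y → T.Adj x z → y = z := by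
    intro x hx y z hy hz
    obtain ⟨i, hi⟩ := hidx hy
    obtain ⟨j, hj⟩ := hidx hz
    have hij : i = j := by
      refine Finset.card_le_one.1 (Nat.lt_succ_iff.1 (not_le.1 hx)) i ?_ j ?_ <;>
        rw [Finset.mem_filter]
      · exact ⟨Finset.mem_univ _, hi ▸ Sym2.mem_mk_left _ _⟩
      · exact ⟨Finset.mem_univ _, hj ▸ Sym2.mem_mk_left _ _⟩
    rw [← hij, hi] at hj
    exact Sym2.congr_right.1 hj
  have hmatch := hH.ncard_edgeSet_add_ncard_isolated_le _ hD
  have hforest := hT.ncard_edgeSet_add_card_connectedComponent_le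
  have hiso : ∀ x, (A x).card = 0 → ∀ y, ¬ T.Adj x y := by
    intro x hx y hxy
    obtain ⟨i, hi⟩ := hidx hxy
    have hmem : i ∈ A x :=
      Finset.mem_filter.2 ⟨Finset.mem_univ _, hi ▸ Sym2.mem_mk_left _ _⟩
    rw [Finset.card_eq_zero.1 hx] at hmem
    exact Finset.notMem_empty _ hmem
  have hsum : Nat.card V + {x | 2 ≤ (A x).card}.ncard ≤
      ∑ x : V, min 2 (A x).card + {x | ∀ y, ¬ T.Adj x y}.ncard := by
    simp only [Set.ncard_eq_toFinset_card', Set.toFinset_ofPred, Finset.card_filter,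
      Nat.card_eq_fintype_card, Fintype.card_eq_sum_ones, ← Finset.sum_add_distrib]
    refine Finset.sum_le_sum fun x _ => ?_
    have := hiso x
    split_ifs with h1 h2 h2 <;> first | omega | (have : (A x).card ≠ 0 := fun h => h2 (this h); omega)
  omega
end

section
/- Let T' be a finite forest, let S' be any ordering (stream) of its edges, and let T be obtained from T' by adding a new vertex w and an edge e = (u,w) to a vertex u of T'. Let S be any stream obtained from S' by inserting e at an arbitrary position. Then the number of 1-good edges of S is at least the number of 1-good edges of S'; that is, inserting a leaf edge anywhere in the stream cannot decrease |E_1|. -/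
open SimpleGraph

variable {V : Type*}

open Classical in
lemma ncard_setOf_fin_succ {n : ℕ} (P : Fin (n + 1) → Prop) :
    {j | P j}.ncard = (if P 0 then 1 else 0) + {j : Fin n | P j.succ}.ncard := by
  have key : ∀ {m : ℕ} (Q : Fin m → Prop), {j | Q j}.ncard = ∑ j, if Q j then 1 else 0 := by
    intro m Q
    rw [Set.ncard_eq_toFinset_card', Finset.sum_boole]
    simp
  rw [key, key, Fin.sum_univ_succ]

/-- The number of positions of the stream `l` whose edge is incident to `x`. -/
noncomputable def incidenceCount (l : List (Sym2 V)) (x : V) : ℕ :=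
  {j : Fin l.length | x ∈ l.get j}.ncard

open Classical in
lemma incidenceCount_cons (a : Sym2 V) (l : List (Sym2 V)) (x : V) :
    incidenceCount (a :: l) x = (if x ∈ a then 1 else 0) + incidenceCount l x := by
  have h := ncard_setOf_fin_succ fun j : Fin (l.length + 1) => x ∈ (a :: l).get j
  convert h <;> rfl

lemma dAfter_cons_zero (a : Sym2 V) (l : List (Sym2 V)) (x : V) :
    dAfter (a :: l) 0 x = incidenceCount l x := by
  have h := ncard_setOf_fin_succ
    fun j : Fin (l.length + 1) => 0 < (j : ℕ) ∧ x ∈ (a :: l).get j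
  simpa [dAfter, incidenceCount] using h

lemma dAfter_cons_succ (a : Sym2 V) (l : List (Sym2 V)) (i : ℕ) (x : V) :
    dAfter (a :: l) (i + 1) x = dAfter l i x := by
  have h := ncard_setOf_fin_succ
    fun j : Fin (l.length + 1) => i + 1 < (j : ℕ) ∧ x ∈ (a :: l).get j
  simpa [dAfter] using h

open Classical in
lemma EalphaCard_one_cons (a : Sym2 V) (l : List (Sym2 V)) :
    EalphaCard (a :: l) 1 =
      (if ∀ x ∈ a, incidenceCount l x ≤ 1 then 1 else 0) + EalphaCard l 1 := by
  have h := ncard_setOf_fin_succ fun i : Fin (l.length + 1) => AlphaGood (a :: l) 1 i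
  simpa [EalphaCard, AlphaGood, dAfter_cons_zero, dAfter_cons_succ] using h

lemma incidenceCount_eq_zero {l : List (Sym2 V)} {x : V} (h : ∀ a ∈ l, x ∉ a) :
    incidenceCount l x = 0 := by
  simp [incidenceCount, h]

open Classical in
lemma incidenceCount_append_cons (l₁ l₂ : List (Sym2 V)) (e : Sym2 V) (x : V) :
    incidenceCount (l₁ ++ e :: l₂) x =
      (if x ∈ e then 1 else 0) + incidenceCount (l₁ ++ l₂) x := by
  induction l₁ with
  | nil => exact incidenceCount_cons e l₂ x
  | cons a l₁ ih =>
    simp only [List.cons_append, incidenceCount_cons, ih]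
    omega

open Classical in
/-- Inserting a leaf edge at `u` gains a `1`-good edge while at most one edge of the stream
is incident to `u`; this slack pays for the single edge that the insertion can spoil. -/
lemma EalphaCard_one_insert_leaf (u w : V) (l₁ l₂ : List (Sym2 V))
    (hw : ∀ a ∈ l₁ ++ l₂, w ∉ a) :
    EalphaCard (l₁ ++ l₂) 1 + (if incidenceCount (l₁ ++ l₂) u ≤ 1 then 1 else 0) ≤
      EalphaCard (l₁ ++ s(u, w) :: l₂) 1 := by
  induction l₁ with
  | nil =>
    have h0 : incidenceCount l₂ w = 0 := incidenceCount_eq_zero hw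
    simp [EalphaCard_one_cons, h0, add_comm]
  | cons a l₁ ih =>
    simp only [List.cons_append, List.forall_mem_cons] at hw
    have ih := ih hw.2
    have hcount : ∀ x ∈ a, x ≠ u →
        incidenceCount (l₁ ++ s(u, w) :: l₂) x = incidenceCount (l₁ ++ l₂) x := by
      intro x hx hxu
      have hxw : x ≠ w := fun h => hw.1 (h ▸ hx)
      simp [incidenceCount_append_cons, hxu, hxw]
    have hu : incidenceCount (l₁ ++ s(u, w) :: l₂) u = 1 + incidenceCount (l₁ ++ l₂) u := by
      simp [incidenceCount_append_cons]
    simp only [List.cons_append, EalphaCard_one_cons, incidenceCount_cons]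
    by_cases hua : u ∈ a
    · by_cases hc : incidenceCount (l₁ ++ l₂) u = 0
      · have hgood : (∀ x ∈ a, incidenceCount (l₁ ++ s(u, w) :: l₂) x ≤ 1) ↔
            ∀ x ∈ a, incidenceCount (l₁ ++ l₂) x ≤ 1 := by
          refine forall₂_congr fun x hx => ?_
          by_cases hxu : x = u
          · subst hxu; omega
          · rw [hcount x hx hxu]
        simp only [hgood, hua, hc, zero_le_one, add_zero, le_refl, if_true] at ih ⊢
        omega
      · by_cases hc1 : incidenceCount (l₁ ++ l₂) u = 1
        · simp only [hua, hc1, le_refl, if_true] at ih ⊢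
          split_ifs <;> omega
        · have hbad : ¬ ∀ x ∈ a, incidenceCount (l₁ ++ l₂) x ≤ 1 := fun h => by
            have := h u hua
            omega
          have hlarge : ¬ 1 + incidenceCount (l₁ ++ l₂) u ≤ 1 := by omega
          simp only [hua, hbad, hlarge, if_true, if_false]
          omega
    · have hgood : (∀ x ∈ a, incidenceCount (l₁ ++ s(u, w) :: l₂) x ≤ 1) ↔
          ∀ x ∈ a, incidenceCount (l₁ ++ l₂) x ≤ 1 := by
        refine forall₂_congr fun x hx => ?_
        rw [hcount x hx fun h => hua (h ▸ hx)]
      simp only [hgood, hua, if_false, zero_add]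
      omega

theorem statement_13 {V : Type*} [Fintype V] (T' : SimpleGraph V) (hT' : T'.IsAcyclic)
    (u w : V) (huw : u ≠ w) (hw : ∀ x, ¬ T'.Adj w x)
    (l₁ l₂ : List (Sym2 V)) (hstream : IsEdgeStream T' (l₁ ++ l₂)) :
    EalphaCard (l₁ ++ l₂) 1 ≤ EalphaCard (l₁ ++ s(u, w) :: l₂) 1 := by
  have hleaf : ∀ a ∈ l₁ ++ l₂, w ∉ a := by
    rintro a ha ⟨y, rfl⟩
    exact hw y ((hstream.2 _).1 ha)
  exact le_of_add_le_left (EalphaCard_one_insert_leaf u w l₁ l₂ hleaf)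
end

section
/- Let S = (e_1, …, e_m) be any ordering (stream) of the edges of a finite simple graph G with arboricity at most c (c ≥ 1), let M* be the size of a maximum matching of G, and let α = 6c. Then for every prefix S_t = (e_1, …, e_t) of S, the number of α-good edges with respect to the stream S_t of the graph G_t = (V, {e_1,…,e_t}) is at most ((5/4)α + 2)·M*; in particular it is at most 4α·M*. -/
open SimpleGraph

variable {V : Type*}

section MatchingBound

/-- A matching of `G` encoded as an involution that moves every vertex it does not fix
to a neighbor; its edges are the pairs `s(x, f x)` with `f x ≠ x`. -/
structure IsMatchingInvolution (G : SimpleGraph V) (f : V → V) : Prop where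
  involutive : Function.Involutive f
  adj_of_ne : ∀ x, f x ≠ x → G.Adj x (f x)

variable {G H : SimpleGraph V} {f g : V → V}

theorem IsMatchingInvolution.mono (hf : IsMatchingInvolution G f) (h : G ≤ H) :
    IsMatchingInvolution H f :=
  ⟨hf.involutive, fun x hx => h (hf.adj_of_ne x hx)⟩

theorem isMatchingInvolution_id : IsMatchingInvolution G (id : V → V) :=
  ⟨fun _ => rfl, fun _ hx => (hx rfl).elim⟩

variable [Fintype V]

open Classical in
/-- The vertices covered by the matching encoded by `f`. -/
noncomputable def movedPoints (f : V → V) : Finset V := {x | f x ≠ x}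

theorem mem_movedPoints {x : V} : x ∈ movedPoints f ↔ f x ≠ x := by
  simp [movedPoints]

theorem IsMatchingInvolution.even_card_movedPoints (hf : IsMatchingInvolution G f) :
    Even (movedPoints f).card := by
  classical
  have h := Equiv.Perm.two_dvd_card_support (σ := hf.involutive.toPerm f)
    (by ext x; simp [sq, hf.involutive x])
  have e : (hf.involutive.toPerm f).support = movedPoints f := by
    ext x; simp [mem_movedPoints]
  rw [e] at h
  exact even_iff_two_dvd.mpr h

/-- A matching missing both ends of an edge can be enlarged. -/
theorem IsMatchingInvolution.exists_card_lt (hf : IsMatchingInvolution G f) {u v : V}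
    (huv : G.Adj u v) (hu : f u = u) (hv : f v = v) :
    ∃ g, IsMatchingInvolution G g ∧ (movedPoints f).card < (movedPoints g).card := by
  classical
  have hne := huv.ne
  have hinv := hf.involutive
  have hadj := hf.adj_of_ne
  refine ⟨fun a => if a = u then v else if a = v then u else f a, ⟨?_, ?_⟩, ?_⟩
  · intro a
    have := hinv a
    grind
  · intro a ha
    have := hadj a
    have := huv.symm
    grind
  · refine Finset.card_lt_card (Finset.ssubset_iff_of_subset ?_ |>.mpr ⟨u, ?_, ?_⟩)
    · intro a
      simp only [mem_movedPoints]
      grind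
    · simp only [mem_movedPoints]
      grind
    · simpa [mem_movedPoints] using hu

/-- Two matchings of the largest size `n`, one missing `u` and `w`, the other missing `v` but
covering `u` and `w`: some matching of size `n` misses `v` together with `u` or `w`. -/
theorem exists_isMatchingInvolution_fixing_pair {n : ℕ}
    (hmax : ∀ f, IsMatchingInvolution G f → (movedPoints f).card ≤ n) {u v w : V} (huw : u ≠ w)
    (hf : IsMatchingInvolution G f) (hfn : (movedPoints f).card = n) (hfu : f u = u)
    (hfw : f w = w)
    (hg : ∃ g, IsMatchingInvolution G g ∧ (movedPoints g).card = n ∧ g v = v) :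
    ∃ h, IsMatchingInvolution G h ∧ (movedPoints h).card = n ∧ h v = v ∧
      (h u = u ∨ h w = w) := by
  classical
  by_contra! hcon
  obtain ⟨g, ⟨hg, hgn, hgv⟩, hgmax⟩ := Finset.exists_max_image
    (Finset.univ.filter fun g : V → V =>
      IsMatchingInvolution G g ∧ (movedPoints g).card = n ∧ g v = v)
    (fun g => (Finset.univ.filter fun a => f a = g a).card)
    (by obtain ⟨g, hg⟩ := hg; exact ⟨g, by simpa using hg⟩) |>.imp
    fun g h => by simpa only [Finset.mem_filter, Finset.mem_univ, true_and] using h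
  obtain ⟨hgu, hgw⟩ := hcon g hg hgn hgv
  have hcard : 1 < (movedPoints f \ movedPoints g).card := by
    rw [Finset.card_sdiff_comm (hfn.trans hgn.symm)]
    exact Finset.one_lt_card.mpr
      ⟨u, by simp [mem_movedPoints, hfu, hgu], w, by simp [mem_movedPoints, hfw, hgw], huw⟩
  obtain ⟨x, hx, hxv⟩ := Finset.exists_mem_ne hcard v
  simp only [Finset.mem_sdiff, mem_movedPoints, not_not] at hx
  obtain ⟨hfx, hgx⟩ := hx
  have hxy := hf.adj_of_ne x hfx
  have hffx := hf.involutive x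
  obtain ⟨y, hy⟩ : ∃ y, y = f x := ⟨_, rfl⟩
  rw [← hy] at hfx hxy hffx
  have hgy : g y ≠ y := by
    intro hgy
    obtain ⟨g', hg', hlt⟩ := hg.exists_card_lt hxy hgx hgy
    exact absurd (hmax g' hg') (by omega)
  have hginv := hg.involutive
  have hggy := hginv y
  obtain ⟨z, hz⟩ : ∃ z, z = g y := ⟨_, rfl⟩
  rw [← hz] at hgy hggy
  have hzx : z ≠ x := by grind
  have hyv : y ≠ v := by grind
  set g' : V → V := fun a => if a = x then y else if a = y then x else if a = z then z else g a
    with hg'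
  have hg'm : IsMatchingInvolution G g' := by
    refine ⟨fun a => ?_, fun a ha => ?_⟩
    · have := hginv a
      grind
    · have := hg.adj_of_ne a
      have := hxy.symm
      grind
  have hmoved : movedPoints g' = insert x ((movedPoints g).erase z) := by
    ext a
    simp only [Finset.mem_insert, Finset.mem_erase, mem_movedPoints]
    grind
  have hcard' : (movedPoints g').card = n := by
    rw [hmoved, Finset.card_insert_of_notMem (by simp [mem_movedPoints, hgx]),
      Finset.card_erase_add_one (by simp [mem_movedPoints, hggy, hgy.symm]), hgn]
  have hle := hgmax g' ⟨hg'm, hcard', by grind⟩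
  refine absurd hle (not_le.mpr (Finset.card_lt_card
    (Finset.ssubset_iff_of_subset ?_ |>.mpr ⟨x, ?_, ?_⟩)))
  · intro a
    have := hf.involutive a
    simp only [Finset.mem_filter, Finset.mem_univ, true_and]
    grind
  · simp only [Finset.mem_filter, Finset.mem_univ, true_and]
    grind
  · simp only [Finset.mem_filter, Finset.mem_univ, true_and]
    grind

open Classical in
/-- Gallai's lemma gives the degree sum bound when every vertex is missed by some maximum
matching. -/
theorem sum_degree_le_of_forall_missed {n d : ℕ} (hd : ∀ v, G.degree v ≤ d)
    (hmax : ∀ f, IsMatchingInvolution G f → (movedPoints f).card ≤ n)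
    (hmiss : ∀ v, ∃ f, IsMatchingInvolution G f ∧ (movedPoints f).card = n ∧ f v = v) :
    ∑ v, G.degree v ≤ (d + 1) * n := by
  rcases isEmpty_or_nonempty V with hV | ⟨⟨v₀⟩⟩
  · simp
  let r : Setoid V :=
    { r := fun u v => u = v ∨ ∀ f, IsMatchingInvolution G f → (movedPoints f).card = n →
        ¬ (f u = u ∧ f v = v)
      iseqv := by
        refine ⟨fun _ => Or.inl rfl, ?_, ?_⟩
        · rintro u v (h | h)
          · exact Or.inl h.symm
          · exact Or.inr fun f hf hn h' => h f hf hn h'.symm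
        · rintro u v w (rfl | huv) (rfl | hvw)
          · exact Or.inl rfl
          · exact Or.inr hvw
          · exact Or.inr huv
          · refine or_iff_not_imp_left.mpr fun huw f hf hn ⟨hfu, hfw⟩ => ?_
            obtain ⟨h, hh, hhn, hv, hu | hw⟩ := exists_isMatchingInvolution_fixing_pair hmax huw
              hf hn hfu hfw (hmiss v)
            · exact huv h hh hhn ⟨hu, hv⟩
            · exact hvw h hh hhn ⟨hv, hw⟩ }
  have hadj : ∀ u v, G.Adj u v → r u v := fun u v huv => Or.inr fun f hf hn ⟨hu, hv⟩ => by
    obtain ⟨g, hg, hlt⟩ := hf.exists_card_lt huv hu hv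
    exact absurd (hmax g hg) (by omega)
  obtain ⟨f, hf, hfn, -⟩ := hmiss v₀
  let C : Quotient r → Finset V := fun q => Finset.univ.filter fun v => (⟦v⟧ : Quotient r) = q
  have hclass : ∀ q, ∑ v ∈ C q, G.degree v ≤
      (d + 1) * ((movedPoints f).filter fun v => (⟦v⟧ : Quotient r) = q).card := by
    intro q
    set m := ((movedPoints f).filter fun v => (⟦v⟧ : Quotient r) = q).card with hm
    have hsplit : (C q).card ≤ m + 1 := by
      have hfix : ((C q).filter fun v => f v = v).card ≤ 1 := by
        refine Finset.card_le_one.mpr fun a ha b hb => ?_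
        simp only [C, Finset.mem_filter, Finset.mem_univ, true_and] at ha hb
        rcases (Quotient.exact (ha.1.trans hb.1.symm) : r a b) with h | h
        · exact h
        · exact absurd ⟨ha.2, hb.2⟩ (h f hf hfn)
      have hmov : ((C q).filter fun v => ¬ f v = v).card = m := by
        rw [hm]
        congr 1
        ext a
        simp [C, mem_movedPoints, and_comm]
      have := Finset.card_filter_add_card_filter_not (s := C q) (fun v => f v = v)
      omega
    have hdeg : ∀ v ∈ C q, G.degree v ≤ m := by
      intro v hv
      have hsub : G.neighborFinset v ⊆ (C q).erase v := by
        intro w hw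
        rw [mem_neighborFinset] at hw
        simp only [C, Finset.mem_filter, Finset.mem_univ, true_and, Finset.mem_erase] at hv ⊢
        exact ⟨hw.ne', (Quotient.sound (hadj v w hw)).symm.trans hv⟩
      have := Finset.card_le_card hsub
      rw [card_neighborFinset_eq_degree, Finset.card_erase_of_mem hv] at this
      omega
    have hsum : ∀ e, (∀ v ∈ C q, G.degree v ≤ e) → ∑ v ∈ C q, G.degree v ≤ (m + 1) * e :=
      fun e he => (Finset.sum_le_card_nsmul _ _ e he).trans (Nat.mul_le_mul_right e hsplit)
    rcases le_total m d with h | h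
    · exact (hsum m hdeg).trans (by gcongr)
    · exact (hsum d fun v _ => hd v).trans (by nlinarith)
  calc ∑ v, G.degree v = ∑ q, ∑ v ∈ C q, G.degree v :=
        (Finset.sum_fiberwise _ _ _).symm
    _ ≤ ∑ q : Quotient r,
        (d + 1) * ((movedPoints f).filter fun v => (⟦v⟧ : Quotient r) = q).card :=
        Finset.sum_le_sum fun q _ => hclass q
    _ = (d + 1) * n := by
        rw [← Finset.mul_sum, ← hfn, Finset.card_eq_sum_card_fiberwise
          (f := fun v => (⟦v⟧ : Quotient r)) (t := Finset.univ) (by simp)]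

open Classical in
/-- A graph of maximum degree at most `d` whose matchings have at most `k` edges has at most
`(d + 1) * k` edges. -/
theorem card_edgeFinset_le_of_matching_le {d k : ℕ} (hd : ∀ v, G.degree v ≤ d)
    (hmax : ∀ f, IsMatchingInvolution G f → (movedPoints f).card ≤ 2 * k) :
    G.edgeFinset.card ≤ (d + 1) * k := by
  induction k generalizing G with
  | zero =>
    have := sum_degree_le_of_forall_missed hd hmax fun v => ⟨id, isMatchingInvolution_id,
      Nat.le_zero.mp (hmax id isMatchingInvolution_id), rfl⟩
    rw [sum_degrees_eq_twice_card_edges] at this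
    omega
  | succ k ih =>
    by_cases hmiss : ∀ v, ∃ f, IsMatchingInvolution G f ∧
        (movedPoints f).card = 2 * (k + 1) ∧ f v = v
    · have := sum_degree_le_of_forall_missed hd hmax hmiss
      rw [sum_degrees_eq_twice_card_edges] at this
      linarith
    · push Not at hmiss
      obtain ⟨v, hv⟩ := hmiss
      obtain ⟨G', hG'⟩ : ∃ G', G' = G.deleteIncidenceSet v := ⟨_, rfl⟩
      have hle : G' ≤ G := hG' ▸ G.deleteIncidenceSet_le v
      have hcard := ih (G := G') (fun w => (degree_le_of_le hle).trans (hd w)) (fun f hf => by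
        have hfv : f v = v := by
          by_contra h
          have := hf.adj_of_ne v h
          simp [hG', deleteIncidenceSet_adj] at this
        have h1 := hmax f (hf.mono hle)
        have h2 : (movedPoints f).card ≠ 2 * (k + 1) := fun h => hv f (hf.mono hle) h hfv
        obtain ⟨j, hj⟩ := hf.even_card_movedPoints
        omega)
      have hdel : G'.edgeFinset.card = G.edgeFinset.card - G.degree v := by
        subst hG'
        convert G.card_edgeFinset_deleteIncidenceSet v
      have := hd v
      rw [mul_add]
      omega

/-- An involution encoding a matching covers at most twice as many vertices as the size of a
maximum matching. -/
theorem IsMatchingInvolution.card_movedPoints_le {M : ℕ} (hM : MaxMatchingSize G M)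
    (hf : IsMatchingInvolution G f) : (movedPoints f).card ≤ 2 * M := by
  classical
  have hinv := hf.involutive
  let K : G.Subgraph :=
    { verts := {x | f x ≠ x}
      Adj := fun x y => f x = y ∧ f x ≠ x
      adj_sub := by
        rintro x y ⟨rfl, h⟩
        exact hf.adj_of_ne x h
      edge_vert := fun h => h.2
      symm := ⟨by
        rintro x y ⟨rfl, h⟩
        exact ⟨hinv x, by rw [hinv x]; exact h.symm⟩⟩ }
  have hK : K.IsMatching := fun x hx => ⟨f x, ⟨rfl, hx⟩, fun y hy => hy.1.symm⟩
  have hle := hM.2 K hK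
  have himg : ((movedPoints f).image fun x => s(x, f x)).card ≤ K.edgeSet.ncard := by
    rw [← Set.ncard_coe_finset]
    refine Set.ncard_le_ncard ?_ (Set.toFinite _)
    intro e he
    simp only [Finset.coe_image, Set.mem_image, Finset.mem_coe, mem_movedPoints] at he
    obtain ⟨x, hx, rfl⟩ := he
    exact ⟨rfl, hx⟩
  have hfib := Finset.card_le_mul_card_image (f := fun x => s(x, f x)) (movedPoints f) 2 (by
    intro e he
    obtain ⟨x, -, rfl⟩ := Finset.mem_image.mp he
    refine (Finset.card_le_card (t := {x, f x}) fun y hy => ?_).trans Finset.card_le_two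
    have := (Finset.mem_filter.mp hy).2
    simp only [Sym2.eq_iff] at this
    simp only [Finset.mem_insert, Finset.mem_singleton]
    tauto)
  omega

end MatchingBound

/-- The vertex `x` lies on at most `a + 1` good edges. -/
theorem ncard_alphaGood_incident_le (l : List (Sym2 V)) (a : ℕ) (x : V) :
    {i : Fin l.length | AlphaGood l a i ∧ x ∈ l.get i}.ncard ≤ a + 1 := by
  set A := {i : Fin l.length | AlphaGood l a i ∧ x ∈ l.get i}
  rcases A.eq_empty_or_nonempty with h | h
  · simp [h]
  · obtain ⟨i, hi, hmin⟩ := Set.exists_min_image A id (Set.toFinite _) h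
    have hsub : A ⊆ insert i {j : Fin l.length | (i : ℕ) < (j : ℕ) ∧ x ∈ l.get j} := by
      intro j hj
      rcases (hmin j hj : i ≤ j).eq_or_lt with h | h
      · exact Or.inl h.symm
      · exact Or.inr ⟨h, hj.2⟩
    have hgood : dAfter l i x ≤ a := by exact_mod_cast hi.1 x hi.2
    exact (Set.ncard_le_ncard hsub (Set.toFinite _)).trans
      ((Set.ncard_insert_le _ _).trans (Nat.add_le_add_right hgood 1))

/-- The number of good edges of a stream of distinct edges of `G` is at most `a + 2` times the
size of a maximum matching. -/
theorem ealphaCard_le_mul_maxMatchingSize [Fintype V] {G : SimpleGraph V} {M : ℕ}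
    (hM : MaxMatchingSize G M) {l : List (Sym2 V)} (hl : l.Nodup) (hG : ∀ e ∈ l, e ∈ G.edgeSet)
    (a : ℕ) : EalphaCard l a ≤ (a + 2) * M := by
  classical
  set A := {i : Fin l.length | AlphaGood l a i}
  obtain ⟨H, hH⟩ : ∃ H, H = SimpleGraph.fromEdgeSet (l.get '' A) := ⟨_, rfl⟩
  have hedge : H.edgeSet = l.get '' A := by
    rw [hH, edgeSet_fromEdgeSet, sdiff_eq_left, Set.disjoint_left]
    rintro _ ⟨i, -, rfl⟩ hdiag
    exact G.not_isDiag_of_mem_edgeSet (hG _ (l.get_mem i)) hdiag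
  have hle : H ≤ G := by
    rw [← edgeSet_subset_edgeSet, hedge]
    rintro _ ⟨i, -, rfl⟩
    exact hG _ (l.get_mem i)
  have hd : ∀ v, H.degree v ≤ a + 1 := by
    intro v
    rw [← card_incidenceFinset_eq_degree, ← Set.ncard_coe_finset, coe_incidenceFinset]
    refine le_trans ?_ (ncard_alphaGood_incident_le l a v)
    refine (Set.ncard_le_ncard ?_ (Set.toFinite _)).trans
      (Set.ncard_image_le (f := l.get) (Set.toFinite _))
    rintro e ⟨he, hv⟩
    rw [hedge] at he
    obtain ⟨i, hi, rfl⟩ := he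
    exact ⟨i, ⟨hi, hv⟩, rfl⟩
  have hbound := card_edgeFinset_le_of_matching_le hd fun f hf =>
    (hf.mono hle).card_movedPoints_le hM
  rw [← Set.ncard_coe_finset, coe_edgeFinset, hedge,
    Set.ncard_image_of_injective _ (List.nodup_iff_injective_get.mp hl)] at hbound
  exact hbound

theorem statement_15 {V : Type*} [Fintype V] (G : SimpleGraph V)
    (c M : ℕ) (hc : 1 ≤ c) (harb : ArboricityLE G c)
    (l : List (Sym2 V)) (hstream : IsEdgeStream G l)
    (hM : MaxMatchingSize G M) (t : ℕ) :
    (EalphaCard (l.take t) (6 * (c : ℝ)) : ℝ) ≤ (5 / 4 * (6 * (c : ℝ)) + 2) * M ∧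
      (EalphaCard (l.take t) (6 * (c : ℝ)) : ℝ) ≤ 4 * (6 * (c : ℝ)) * M := by
  have h := ealphaCard_le_mul_maxMatchingSize hM (hstream.1.sublist (l.take_sublist t))
    (fun e he => (hstream.2 e).mp (List.mem_of_mem_take he)) (6 * c)
  have h' : (EalphaCard (l.take t) (6 * (c : ℝ)) : ℝ) ≤ (6 * (c : ℝ) + 2) * M := by
    exact_mod_cast h
  have hc' : (1 : ℝ) ≤ c := by exact_mod_cast hc
  constructor <;> refine h'.trans (mul_le_mul_of_nonneg_right ?_ M.cast_nonneg) <;> linarith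
end
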